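/- arXiv:1806.02561 — 2 statements merged into one kernel-verified Lean document; each statement's English description precedes it below -/
import Mathlib

section
/- There exists an absolute constant C > 0 with the following property. Let 1 ≤ p ≤ ∞ and let g, h be 2π-periodic functions that are of bounded variation on [0,2π] if p = 1, or satisfy the Lipschitz condition |f(x+δ) − f(x)| ≤ Kδ for all x ∈ ℝ, δ > 0 (with constant K) if 1 < p ≤ ∞. For n ∈ ℕ and α ∈ ℝ set Φ(x) = g(x)cos(nx+α) + h(x)sin(nx+α) and r(x) = √(g(x)² + h(x)²). Then | inf_{c ∈ ℝ} ‖Φ − c‖_p − (2π)^{−1/p} ‖cos t‖_p ‖r‖_p | ≤ C M/n, where M = V_{−π}^{π}(g) + V_{−π}^{π}(h) if p = 1, M = K + p^{−1} ‖r‖_p^{1−p} V_{−π}^{π}(r^p) if 1 < p < ∞, and M = K if p = ∞ (V denoting total variation). -/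
open MeasureTheory Real Set
open scoped ENNReal

/-- The `L_p` "norm" of a (2π-periodic) function over one period `(0, 2π]`. -/
noncomputable def LpNormPer (p : ℝ≥0∞) (f : ℝ → ℝ) : ℝ :=
  (eLpNorm f p (volume.restrict (Ioc (0:ℝ) (2*π)))).toReal

/-- `‖cos t‖_p` over one period. -/
noncomputable def cosLp (p : ℝ≥0∞) : ℝ := LpNormPer p Real.cos

/-- `r(x) = √(g(x)² + h(x)²)`. -/
noncomputable def rGH (g h : ℝ → ℝ) (x : ℝ) : ℝ := Real.sqrt (g x ^ 2 + h x ^ 2)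

/-- The constant `M = M_p` of Lemma 1:
`M₁ = V_{−π}^π(g) + V_{−π}^π(h)`, `M_p = K + p⁻¹‖r‖_p^{1−p} V_{−π}^π(r^p)` for `1<p<∞`,
`M_∞ = K`. -/
noncomputable def MLem (p : ℝ≥0∞) (g h : ℝ → ℝ) (K : ℝ) : ℝ :=
  if p = 1 then
    (eVariationOn g (Icc (-π) π)).toReal + (eVariationOn h (Icc (-π) π)).toReal
  else if p = ∞ then K
  else K + p.toReal⁻¹ * (LpNormPer p (rGH g h)) ^ ((1:ℝ) - p.toReal) *
    (eVariationOn (fun x => rGH g h x ^ p.toReal) (Icc (-π) π)).toReal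


/-- index of the partition interval containing `x` -/
noncomputable def stepIdx (n : ℕ) (x : ℝ) : ℤ := ⌈(n:ℝ) * x / (2*π)⌉

/-- right endpoint of the `k`-th partition interval -/
noncomputable def stepPt (n : ℕ) (k : ℤ) : ℝ := 2*π / n * k

theorem stepIdx_eq {n : ℕ} (hn : 1 ≤ n) (k : ℕ) {x : ℝ}
    (hx : x ∈ Ioc (2*π/n*(k:ℝ)) (2*π/n*((k+1:ℕ):ℝ))) : stepIdx n x = (k:ℤ) + 1 := by
  have hn' : (0:ℝ) < n := by exact_mod_cast hn
  have hpi := Real.pi_pos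
  unfold stepIdx
  rw [Int.ceil_eq_iff]
  obtain ⟨h1, h2⟩ := hx
  rw [div_mul_eq_mul_div, div_lt_iff₀ hn'] at h1
  rw [div_mul_eq_mul_div, le_div_iff₀ hn'] at h2
  push_cast at h2 ⊢
  constructor
  · rw [lt_div_iff₀ (by positivity)]; linarith
  · rw [div_le_iff₀ (by positivity)]; linarith

theorem step_integral {n : ℕ} (hn : 1 ≤ n) (F : ℤ → ℝ → ℝ) (hc : ∀ k, Continuous (F k))
    (hp : ∀ k, Function.Periodic (F k) (2*π)) :
    IntervalIntegrable (fun x => F (stepIdx n x) (n*x)) volume 0 (2*π) ∧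
    ∫ x in (0:ℝ)..(2*π), F (stepIdx n x) (n*x) =
      (n:ℝ)⁻¹ * ∑ k ∈ Finset.range n, ∫ t in (0:ℝ)..(2*π), F ((k:ℤ)+1) t := by
  have hn' : (0:ℝ) < n := by exact_mod_cast hn
  have hpi := Real.pi_pos
  have hle : ∀ k : ℕ, 2*π/n*(k:ℝ) ≤ 2*π/n*((k+1:ℕ):ℝ) := by
    intro k
    push_cast
    have : 0 < 2*π/n := by positivity
    nlinarith
  have hI : ∀ k < n, IntervalIntegrable (fun x => F (stepIdx n x) (n*x)) volume
      ((fun k : ℕ => 2*π/n*(k:ℝ)) k) ((fun k : ℕ => 2*π/n*(k:ℝ)) (k+1)) := by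
    intro k _
    have hcont : Continuous (fun x : ℝ => F ((k:ℤ)+1) (n*x)) := (hc _).comp (by fun_prop)
    refine IntervalIntegrable.congr ?_ (hcont.intervalIntegrable _ _)
    intro x hx
    rw [uIoc_of_le (hle k)] at hx
    simp only [stepIdx_eq hn k hx]
  have e0 : 2*π/n*((0:ℕ):ℝ) = 0 := by simp
  have en : 2*π/n*((n:ℕ):ℝ) = 2*π := by
    field_simp
  constructor
  · have := IntervalIntegrable.trans_iterate hI
    rwa [e0, en] at this
  · have := intervalIntegral.sum_integral_adjacent_intervals hI
    rw [e0, en] at this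
    rw [← this, Finset.mul_sum]
    refine Finset.sum_congr rfl fun k _ => ?_
    have h1 : ∫ x in (2*π/n*(k:ℝ))..(2*π/n*((k+1:ℕ):ℝ)), F (stepIdx n x) (n*x) =
        ∫ x in (2*π/n*(k:ℝ))..(2*π/n*((k+1:ℕ):ℝ)), F ((k:ℤ)+1) (n*x) := by
      refine intervalIntegral.integral_congr_ae (Filter.Eventually.of_forall fun x hx => ?_)
      rw [uIoc_of_le (hle k)] at hx
      simp only [stepIdx_eq hn k hx]
    rw [h1, intervalIntegral.integral_comp_mul_left _ hn'.ne', smul_eq_mul]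
    congr 1
    have e1 : (n:ℝ) * (2*π/n*(k:ℝ)) = 2*π*k := by field_simp
    have e2 : (n:ℝ) * (2*π/n*((k+1:ℕ):ℝ)) = 2*π*k + 2*π := by push_cast; field_simp
    rw [e1, e2, (hp _).intervalIntegral_add_eq _ 0, zero_add]

theorem amp (u v : ℝ) : ∃ β : ℝ, ∀ t, u * cos t + v * sin t = √(u^2+v^2) * cos (t - β) := by
  refine ⟨Complex.arg ⟨u, v⟩, fun t => ?_⟩
  have h1 := Complex.norm_mul_cos_arg ⟨u, v⟩
  have h2 := Complex.norm_mul_sin_arg ⟨u, v⟩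
  have h3 : ‖(⟨u, v⟩ : ℂ)‖ = √(u^2+v^2) := by
    rw [Complex.norm_eq_sqrt_sq_add_sq]
  rw [h3] at h1 h2
  simp only at h1 h2
  rw [cos_sub]
  nth_rewrite 1 [← h1]
  nth_rewrite 3 [← h2]
  ring

theorem amp' (u v α : ℝ) :
    ∃ β : ℝ, ∀ t, u * cos (t+α) + v * sin (t+α) = √(u^2+v^2) * cos (t + β) := by
  obtain ⟨β, h⟩ := amp u v
  exact ⟨α - β, fun t => by rw [h]; ring_nf⟩

theorem abs_rpow_mid {q : ℝ} (hq : 1 ≤ q) (a c : ℝ) :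
    2 * |a| ^ q ≤ |a - c| ^ q + |a + c| ^ q := by
  have h := (convexOn_rpow hq).2 (mem_Ici.2 (abs_nonneg (a-c)))
    (mem_Ici.2 (abs_nonneg (a+c)))
    (show (0:ℝ) ≤ 1/2 by norm_num) (show (0:ℝ) ≤ 1/2 by norm_num) (by norm_num)
  simp only [smul_eq_mul] at h
  have h2 : |a| ≤ 1/2 * |a-c| + 1/2 * |a+c| := by
    have := abs_add_le (a-c) (a+c)
    have e : a - c + (a + c) = 2 * a := by ring
    rw [e, abs_mul, abs_two] at this
    linarith
  have h3 := rpow_le_rpow (abs_nonneg a) h2 (by linarith : (0:ℝ) ≤ q)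
  linarith

theorem int_shift (f : ℝ → ℝ) (hf : Function.Periodic f (2*π)) (β : ℝ) :
    ∫ t in (0:ℝ)..(2*π), f (t + β) = ∫ t in (0:ℝ)..(2*π), f t := by
  rw [intervalIntegral.integral_comp_add_right, zero_add, add_comm (2*π) β,
    hf.intervalIntegral_add_eq β 0, zero_add]

theorem period_lower {q : ℝ} (hq : 1 ≤ q) (u v α c : ℝ) :
    (√(u^2+v^2)) ^ q * ∫ t in (0:ℝ)..(2*π), |cos t| ^ q ≤
      ∫ t in (0:ℝ)..(2*π), |u * cos (t+α) + v * sin (t+α) - c| ^ q := by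
  obtain ⟨β, h⟩ := amp' u v α
  simp_rw [h]
  set ρ := √(u^2+v^2)
  have hq0 : 0 ≤ q := by linarith
  have hρ : 0 ≤ ρ := sqrt_nonneg _
  have hper : Function.Periodic (fun t => |ρ * cos t - c| ^ q) (2*π) := by
    intro t; simp
  have e1 := int_shift _ hper β
  have e2 := int_shift _ hper π
  simp only [cos_add_pi] at e1 e2
  rw [e1]
  have c1 : Continuous (fun t => |ρ * cos t - c| ^ q) :=
    Continuous.rpow_const (by fun_prop) (fun _ => Or.inr hq0)
  have c2 : Continuous (fun t => |ρ * -cos t - c| ^ q) :=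
    Continuous.rpow_const (by fun_prop) (fun _ => Or.inr hq0)
  have c3 : Continuous (fun t => |cos t| ^ q) :=
    Continuous.rpow_const (by fun_prop) (fun _ => Or.inr hq0)
  have key : ∫ t in (0:ℝ)..(2*π), 2 * (ρ ^ q * |cos t| ^ q) ≤
      ∫ t in (0:ℝ)..(2*π), (|ρ * cos t - c| ^ q + |ρ * -cos t - c| ^ q) := by
    refine intervalIntegral.integral_mono_on (by positivity) ?_ ?_ ?_
    · exact (continuous_const.mul (continuous_const.mul c3)).intervalIntegrable _ _
    · exact (c1.add c2).intervalIntegrable _ _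
    · intro t _
      have := abs_rpow_mid hq (ρ * cos t) c
      rw [abs_mul, abs_of_nonneg hρ, mul_rpow hρ (abs_nonneg _)] at this
      have e : |ρ * -cos t - c| = |ρ * cos t + c| := by
        rw [← abs_neg]; ring_nf
      rw [e]
      exact this
  rw [intervalIntegral.integral_add (c1.intervalIntegrable _ _) (c2.intervalIntegrable _ _), e2,
    intervalIntegral.integral_const_mul, intervalIntegral.integral_const_mul] at key
  linarith

theorem period_eq {q : ℝ} (u v α : ℝ) :
    ∫ t in (0:ℝ)..(2*π), |u * cos (t+α) + v * sin (t+α)| ^ q =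
    (√(u^2+v^2)) ^ q * ∫ t in (0:ℝ)..(2*π), |cos t| ^ q := by
  obtain ⟨β, h⟩ := amp' u v α
  simp_rw [h]
  have hρ : 0 ≤ √(u^2+v^2) := sqrt_nonneg _
  have hper : Function.Periodic (fun t => |cos t| ^ q) (2*π) := by
    intro t; simp
  have e1 := int_shift _ hper β
  rw [← e1, ← intervalIntegral.integral_const_mul]
  congr 1
  ext t
  rw [abs_mul, abs_of_nonneg hρ, mul_rpow hρ (abs_nonneg _)]

/-- Lebesgue measure on the period -/
noncomputable abbrev perMeas : Measure ℝ := volume.restrict (Ioc (0:ℝ) (2*π))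

theorem lp_eq {p : ℝ≥0∞} (hp1 : 1 ≤ p) (hpt : p ≠ ∞) {f : ℝ → ℝ} (hf : MemLp f p perMeas) :
    LpNormPer p f = (∫ x in (0:ℝ)..(2*π), |f x| ^ p.toReal) ^ p.toReal⁻¹ := by
  have h0 : p ≠ 0 := by positivity
  unfold LpNormPer
  rw [hf.eLpNorm_eq_integral_rpow_norm h0 hpt, ENNReal.toReal_ofReal,
    intervalIntegral.integral_of_le (by positivity)]
  · simp only [Real.norm_eq_abs]
  · apply rpow_nonneg
    apply integral_nonneg
    intro x
    positivity

theorem lp_nonneg (p : ℝ≥0∞) (f : ℝ → ℝ) : 0 ≤ LpNormPer p f := ENNReal.toReal_nonneg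

theorem lp_mono {p : ℝ≥0∞} {f e : ℝ → ℝ} (he : MemLp e p perMeas) 
    (h : ∀ x ∈ Ioc 0 (2*π), |f x| ≤ e x) :
    LpNormPer p f ≤ LpNormPer p e := by
  apply ENNReal.toReal_mono he.2.ne
  exact eLpNorm_mono_ae_real (ae_restrict_of_forall_mem measurableSet_Ioc h)

theorem lp_tri {p : ℝ≥0∞} (hp1 : 1 ≤ p) {f1 f2 e : ℝ → ℝ} (h2 : MemLp f2 p perMeas)
    (h1 : MemLp f1 p perMeas) (he : MemLp e p perMeas) (h : ∀ x, |f1 x - f2 x| ≤ e x) :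
    LpNormPer p f1 ≤ LpNormPer p f2 + LpNormPer p e := by
  have hs : LpNormPer p (f1 - f2) ≤ LpNormPer p e := lp_mono he fun x _ => h x
  have h3 : eLpNorm f1 p perMeas ≤ eLpNorm f2 p perMeas + eLpNorm (f1 - f2) p perMeas := by
    have := eLpNorm_add_le h2.1 (h1.sub h2).1 hp1
    simpa using this
  have h4 := ENNReal.toReal_mono (ENNReal.add_ne_top.2 ⟨h2.2.ne, (h1.sub h2).2.ne⟩) h3
  rw [ENNReal.toReal_add h2.2.ne (h1.sub h2).2.ne] at h4
  unfold LpNormPer at *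
  linarith

theorem sqrt_sq_lip (a b c d : ℝ) : |√(a^2+b^2) - √(c^2+d^2)| ≤ |a-c| + |b-d| := by
  have h : ∀ a b c d : ℝ, √(a^2+b^2) ≤ √(c^2+d^2) + (|a-c|+|b-d|) := by
    intro a b c d
    have e1 := sqrt_nonneg (c^2+d^2)
    have e2 := sq_sqrt (show 0 ≤ c^2+d^2 by positivity)
    have e3 : |c| ≤ √(c^2+d^2) := abs_le_sqrt (by nlinarith)
    have e4 : |d| ≤ √(c^2+d^2) := abs_le_sqrt (by nlinarith)
    have e5 : c*(a-c) ≤ √(c^2+d^2) * |a-c| := by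
      calc c*(a-c) ≤ |c*(a-c)| := le_abs_self _
        _ = |c| * |a-c| := abs_mul _ _
        _ ≤ _ := by gcongr
    have e6 : d*(b-d) ≤ √(c^2+d^2) * |b-d| := by
      calc d*(b-d) ≤ |d*(b-d)| := le_abs_self _
        _ = |d| * |b-d| := abs_mul _ _
        _ ≤ _ := by gcongr
    have e7 := sq_abs (a-c)
    have e8 := sq_abs (b-d)
    have e9 : 0 ≤ |a-c| * |b-d| := by positivity
    apply sqrt_le_iff.2 ⟨by positivity, ?_⟩
    nlinarith
  rw [abs_le]
  have h1 := h a b c d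
  have h2 := h c d a b
  rw [abs_sub_comm c a, abs_sub_comm d b] at h2
  constructor <;> linarith

theorem trig_lip (u v C S : ℝ) (hC : |C| ≤ 1) (hS : |S| ≤ 1) : |u * C + v * S| ≤ |u| + |v| := by
  calc _ ≤ |u * C| + |v * S| := abs_add_le _ _
    _ = |u| * |C| + |v| * |S| := by rw [abs_mul, abs_mul]
    _ ≤ |u| * 1 + |v| * 1 := by gcongr
    _ = _ := by ring

theorem step_meas (n : ℕ) (g : ℤ → ℝ) : Measurable (fun x => g (stepIdx n x)) := by
  have h1 : Measurable (stepIdx n) := by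
    unfold stepIdx
    exact Int.measurable_ceil.comp (by fun_prop)
  exact (measurable_from_top (f := g)).comp h1

theorem step_memLp {n : ℕ} (hn : 1 ≤ n) {p : ℝ≥0∞} (hp1 : 1 ≤ p) (hpt : p ≠ ∞) (g : ℤ → ℝ) :
    MemLp (fun x => g (stepIdx n x)) p perMeas := by
  have h0 : p ≠ 0 := by positivity
  rw [← integrable_norm_rpow_iff (step_meas n g).aestronglyMeasurable h0 hpt]
  have := (step_integral hn (fun k _ => ‖g k‖ ^ p.toReal) (fun _ => continuous_const)
    (fun k t => rfl)).1
  rw [intervalIntegrable_iff_integrableOn_Ioc_of_le (by positivity)] at this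
  exact this

theorem memLp_trig {p : ℝ≥0∞} {g h : ℝ → ℝ} (hg : MemLp g p perMeas) (hh : MemLp h p perMeas)
    (a α c : ℝ) : MemLp (fun x => g x * cos (a * x + α) + h x * sin (a * x + α) - c) p perMeas := by
  refine MemLp.sub (f := fun x => g x * cos (a * x + α) + h x * sin (a * x + α)) (g := fun _ => c)
    ?_ (memLp_const c)
  refine MemLp.mono' (g := fun x => |g x| + |h x|) (hg.norm.add hh.norm) ?_ ?_
  · have c1 : Continuous (fun x : ℝ => cos (a * x + α)) := by fun_prop
    have c2 : Continuous (fun x : ℝ => sin (a * x + α)) := by fun_prop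
    exact (hg.1.mul c1.aestronglyMeasurable).add (hh.1.mul c2.aestronglyMeasurable)
  · exact Filter.Eventually.of_forall fun x =>
      trig_lip _ _ _ _ (abs_cos_le_one _) (abs_sin_le_one _)

theorem memLp_r {p : ℝ≥0∞} {g h : ℝ → ℝ} (hg : MemLp g p perMeas) (hh : MemLp h p perMeas) :
    MemLp (rGH g h) p perMeas := by
  refine MemLp.mono' (g := fun x => |g x| + |h x|) (hg.norm.add hh.norm) ?_ ?_
  · have : Continuous (fun z : ℝ × ℝ => √(z.1^2+z.2^2)) := by fun_prop
    exact this.comp_aestronglyMeasurable (hg.1.prodMk hh.1)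
  · refine Filter.Eventually.of_forall fun x => ?_
    have := sqrt_sq_lip (g x) (h x) 0 0
    simpa [rGH] using this

/-- the step approximation -/
noncomputable def stepF (n : ℕ) (g : ℝ → ℝ) (x : ℝ) : ℝ := g (stepPt n (stepIdx n x))

theorem cos_memLp (p : ℝ≥0∞) : MemLp Real.cos p perMeas :=
  MemLp.of_bound (by fun_prop) 1 (Filter.Eventually.of_forall abs_cos_le_one)

theorem kappa_nonneg (p : ℝ≥0∞) : 0 ≤ (2*π) ^ (-(1/p.toReal)) * cosLp p :=
  mul_nonneg (by positivity) (lp_nonneg _ _)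

theorem kappa_le (p : ℝ≥0∞) :
    (2*π) ^ (-(1/p.toReal)) * cosLp p ≤ 1 := by
  have hpi := Real.pi_pos
  have h : cosLp p ≤ (2*π) ^ (1/p.toReal) := by
    unfold cosLp LpNormPer
    have := eLpNorm_le_of_ae_bound (p := p) (μ := perMeas) (f := Real.cos) (C := 1)
      (Filter.Eventually.of_forall abs_cos_le_one)
    have h2 := ENNReal.toReal_mono (by
      simp only [ENNReal.ofReal_one, mul_one]
      exact ENNReal.rpow_ne_top_of_nonneg (by positivity) (measure_ne_top _ _)) this
    refine h2.trans (le_of_eq ?_)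
    simp [← ENNReal.toReal_rpow, ENNReal.toReal_ofReal, hpi.le]
  rw [rpow_neg (by positivity), ← div_eq_inv_mul, div_le_one (by positivity)]
  exact h

theorem step_r_norm {n : ℕ} (hn : 1 ≤ n) {p : ℝ≥0∞} (hp1 : 1 ≤ p) (hpt : p ≠ ∞) (g h : ℝ → ℝ) :
    LpNormPer p (rGH (stepF n g) (stepF n h)) = ((n:ℝ)⁻¹ * ∑ k ∈ Finset.range n,
      (2 * π) * (rGH g h (stepPt n ((k:ℤ)+1))) ^ p.toReal) ^ p.toReal⁻¹ := by
  have m := step_memLp hn hp1 hpt (fun k => rGH g h (stepPt n k))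
  have := lp_eq hp1 hpt m
  have e : rGH (stepF n g) (stepF n h) = fun x => rGH g h (stepPt n (stepIdx n x)) := rfl
  rw [e, this, (step_integral hn (fun k _ => |rGH g h (stepPt n k)| ^ p.toReal)
    (fun _ => continuous_const) (fun k t => rfl)).2]
  congr 2
  refine Finset.sum_congr rfl fun k _ => ?_
  rw [intervalIntegral.integral_const, abs_of_nonneg (show 0 ≤ rGH g h _ from sqrt_nonneg _)]
  simp

theorem step_phi_norm {n : ℕ} (hn : 1 ≤ n) {p : ℝ≥0∞} (hp1 : 1 ≤ p) (hpt : p ≠ ∞) (g h : ℝ → ℝ)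
    (α c : ℝ) :
    LpNormPer p (fun x => stepF n g x * cos (n*x+α) + stepF n h x * sin (n*x+α) - c) =
    ((n:ℝ)⁻¹ * ∑ k ∈ Finset.range n, ∫ t in (0:ℝ)..(2*π),
      |g (stepPt n ((k:ℤ)+1)) * cos (t+α) + h (stepPt n ((k:ℤ)+1)) * sin (t+α) - c| ^ p.toReal)
       ^ p.toReal⁻¹ := by
  have m1 := step_memLp hn hp1 hpt (fun k => g (stepPt n k))
  have m2 := step_memLp hn hp1 hpt (fun k => h (stepPt n k))
  have := lp_eq hp1 hpt (memLp_trig m1 m2 n α c)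
  refine this.trans ?_
  rw [← (step_integral hn (fun k t => |g (stepPt n k) * cos (t+α) + h (stepPt n k) * sin (t+α) - c|
     ^ p.toReal) ?_ ?_).2]
  · intro k
    exact Continuous.rpow_const (by fun_prop) (fun _ => Or.inr (by positivity))
  · intro k t
    have : t + 2*π + α = t + α + 2*π := by ring
    simp only [this, cos_add_two_pi, sin_add_two_pi]

theorem kappa_eq {n : ℕ} (hn : 1 ≤ n) {p : ℝ≥0∞} (hp1 : 1 ≤ p) (hpt : p ≠ ∞) (g h : ℝ → ℝ) :
    (2*π) ^ (-(1/p.toReal)) * cosLp p * LpNormPer p (rGH (stepF n g) (stepF n h)) =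
    ((n:ℝ)⁻¹ * ∑ k ∈ Finset.range n, (rGH g h (stepPt n ((k:ℤ)+1))) ^ p.toReal *
      ∫ t in (0:ℝ)..(2*π), |cos t| ^ p.toReal) ^ p.toReal⁻¹ := by
  have hpi := Real.pi_pos
  have hB : 0 ≤ ∫ t in (0:ℝ)..(2*π), |cos t| ^ p.toReal :=
    intervalIntegral.integral_nonneg (by positivity) fun t _ => by positivity
  rw [step_r_norm hn hp1 hpt, cosLp, lp_eq hp1 hpt (cos_memLp p)]
  rw [← Finset.mul_sum, ← Finset.sum_mul]
  have hS : 0 ≤ ∑ k ∈ Finset.range n, (rGH g h (stepPt n ((k:ℤ)+1))) ^ p.toReal :=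
    Finset.sum_nonneg fun k _ => rpow_nonneg (sqrt_nonneg _) _
  rw [one_div, rpow_neg (by positivity), ← inv_rpow (by positivity),
    ← mul_rpow (by positivity) hB, ← mul_rpow (by positivity) (by positivity)]
  congr 1
  field_simp

theorem main_finite {n : ℕ} (hn : 1 ≤ n) {p : ℝ≥0∞} (hp1 : 1 ≤ p) (hpt : p ≠ ∞) {g h : ℝ → ℝ}
    (hg : MemLp g p perMeas) (hh : MemLp h p perMeas) (α : ℝ) :
    |(⨅ c : ℝ, LpNormPer p
          (fun x => g x * Real.cos ((n:ℝ)*x + α) + h x * Real.sin ((n:ℝ)*x + α) - c)) -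
        (2*π) ^ (-(1/p.toReal)) * cosLp p * LpNormPer p (rGH g h)| ≤
      2 * LpNormPer p (fun x => |g x - stepF n g x| + |h x - stepF n h x|) := by
  have hq : 1 ≤ p.toReal := by
    have := ENNReal.toReal_mono hpt hp1
    simpa using this
  have mG : MemLp (stepF n g) p perMeas := step_memLp hn hp1 hpt (fun k => g (stepPt n k))
  have mH : MemLp (stepF n h) p perMeas := step_memLp hn hp1 hpt (fun k => h (stepPt n k))
  set e := fun x => |g x - stepF n g x| + |h x - stepF n h x| with he
  have me : MemLp e p perMeas := (hg.sub mG).norm.add (hh.sub mH).norm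
  set D := LpNormPer p e
  have hD : 0 ≤ D := lp_nonneg _ _
  set κ := (2*π) ^ (-(1/p.toReal)) * cosLp p with hκ
  have hκ0 : 0 ≤ κ := kappa_nonneg p
  have hκ1 : κ ≤ 1 := kappa_le p
  have mr := memLp_r hg hh
  have mR := memLp_r mG mH
  have r1 : LpNormPer p (rGH g h) ≤ LpNormPer p (rGH (stepF n g) (stepF n h)) + D :=
    lp_tri hp1 mR mr me fun x => sqrt_sq_lip _ _ _ _
  have r2 : LpNormPer p (rGH (stepF n g) (stepF n h)) ≤ LpNormPer p (rGH g h) + D :=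
    lp_tri hp1 mr mR me fun x => by
      rw [abs_sub_comm]; exact sqrt_sq_lip _ _ _ _
  have hdiff : ∀ c x, |(g x * cos (n*x+α) + h x * sin (n*x+α) - c) -
      (stepF n g x * cos (n*x+α) + stepF n h x * sin (n*x+α) - c)| ≤ e x := by
    intro c x
    have : (g x * cos (n*x+α) + h x * sin (n*x+α) - c) -
      (stepF n g x * cos (n*x+α) + stepF n h x * sin (n*x+α) - c) =
      (g x - stepF n g x) * cos (n*x+α) + (h x - stepF n h x) * sin (n*x+α) := by ring
    rw [this]
    exact trig_lip _ _ _ _ (abs_cos_le_one _) (abs_sin_le_one _)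
  have f1 : ∀ c, κ * LpNormPer p (rGH (stepF n g) (stepF n h)) ≤
      LpNormPer p (fun x => stepF n g x * cos (n*x+α) + stepF n h x * sin (n*x+α) - c) := by
    intro c
    rw [step_phi_norm hn hp1 hpt, hκ, kappa_eq hn hp1 hpt]
    have hB : 0 ≤ ∫ t in (0:ℝ)..(2*π), |cos t| ^ p.toReal :=
      intervalIntegral.integral_nonneg (by positivity) fun t _ => by positivity
    refine rpow_le_rpow ?_ ?_ (by positivity)
    · refine mul_nonneg (by positivity) (Finset.sum_nonneg fun k _ => ?_)
      exact mul_nonneg (rpow_nonneg (sqrt_nonneg _) _) hB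
    · gcongr with k _
      exact period_lower hq _ _ _ _
  have f2 : LpNormPer p (fun x => stepF n g x * cos (n*x+α) + stepF n h x * sin (n*x+α) - 0) =
      κ * LpNormPer p (rGH (stepF n g) (stepF n h)) := by
    rw [step_phi_norm hn hp1 hpt, hκ, kappa_eq hn hp1 hpt]
    congr 2
    refine Finset.sum_congr rfl fun k _ => ?_
    simp only [sub_zero]
    exact period_eq _ _ _
  have t1 : ∀ c, LpNormPer p
      (fun x => stepF n g x * cos (n*x+α) + stepF n h x * sin (n*x+α) - c) ≤
      LpNormPer p (fun x => g x * cos (n*x+α) + h x * sin (n*x+α) - c) + D := fun c =>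
    lp_tri hp1 (memLp_trig hg hh _ _ _) (memLp_trig mG mH _ _ _) me fun x => by
      rw [abs_sub_comm]; exact hdiff c x
  have t2 : LpNormPer p (fun x => g x * cos (n*x+α) + h x * sin (n*x+α) - 0) ≤ LpNormPer p
      (fun x => stepF n g x * cos (n*x+α) + stepF n h x * sin (n*x+α) - 0) + D :=
    lp_tri hp1 (memLp_trig mG mH _ _ _) (memLp_trig hg hh _ _ _) me (hdiff 0)
  have lo : κ * LpNormPer p (rGH (stepF n g) (stepF n h)) - D ≤ ⨅ c : ℝ, LpNormPer p
      (fun x => g x * cos (n*x+α) + h x * sin (n*x+α) - c) := by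
    apply le_ciInf
    intro c
    linarith [f1 c, t1 c]
  have hi : (⨅ c : ℝ, LpNormPer p
      (fun x => g x * cos (n*x+α) + h x * sin (n*x+α) - c)) ≤
      κ * LpNormPer p (rGH (stepF n g) (stepF n h)) + D := by
    refine (ciInf_le ⟨0, ?_⟩ 0).trans (by linarith)
    rintro _ ⟨c, rfl⟩
    exact lp_nonneg _ _
  have k1 := mul_le_mul_of_nonneg_left r1 hκ0
  have k2 := mul_le_mul_of_nonneg_left r2 hκ0
  have k3 := mul_le_mul_of_nonneg_right hκ1 hD
  rw [abs_le]
  constructor <;> nlinarith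

theorem stepPt_bounds {n : ℕ} (hn : 1 ≤ n) (x : ℝ) :
    x ≤ stepPt n (stepIdx n x) ∧ stepPt n (stepIdx n x - 1) < x ∧
    stepPt n (stepIdx n x - 1) = stepPt n (stepIdx n x) - 2*π/n := by
  have hn' : (0:ℝ) < n := by exact_mod_cast hn
  have hpi := Real.pi_pos
  have h1 := Int.le_ceil ((n:ℝ)*x/(2*π))
  have h2 := Int.ceil_lt_add_one ((n:ℝ)*x/(2*π))
  rw [div_le_iff₀ (by positivity)] at h1
  rw [← sub_lt_iff_lt_add, lt_div_iff₀ (by positivity)] at h2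
  unfold stepPt stepIdx
  refine ⟨?_, ?_, ?_⟩
  · rw [div_mul_eq_mul_div, le_div_iff₀ hn']; linarith
  · rw [div_mul_eq_mul_div, div_lt_iff₀ hn']; push_cast; linarith
  · push_cast; ring

theorem stepPt_mem {n : ℕ} (hn : 1 ≤ n) {x : ℝ} (hx : x ∈ Ioc 0 (2*π)) :
    0 ≤ stepPt n (stepIdx n x - 1) ∧ stepPt n (stepIdx n x) ≤ 2*π := by
  have hn' : (0:ℝ) < n := by exact_mod_cast hn
  have hpi := Real.pi_pos
  have h1 : 1 ≤ stepIdx n x := by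
    apply Int.ceil_pos.2
    have := hx.1
    positivity
  have h2 : stepIdx n x ≤ n := by
    apply Int.ceil_le.2
    rw [div_le_iff₀ (by positivity)]
    have := hx.2
    push_cast
    nlinarith
  have h1' : (1:ℝ) ≤ stepIdx n x := by exact_mod_cast h1
  have h2' : (stepIdx n x : ℝ) ≤ n := by exact_mod_cast h2
  unfold stepPt
  constructor
  · apply mul_nonneg (by positivity); push_cast; linarith
  · rw [div_mul_eq_mul_div, div_le_iff₀ hn']; nlinarith

theorem lip_abs {g : ℝ → ℝ} {K : ℝ} (hg : ∀ x δ : ℝ, 0 < δ → |g (x + δ) - g x| ≤ K * δ) (x y : ℝ) :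
    |g x - g y| ≤ K * |x - y| := by
  rcases lt_trichotomy x y with h | h | h
  · have := hg x (y - x) (by linarith)
    rw [add_sub_cancel] at this
    rw [abs_sub_comm, abs_sub_comm x y, abs_of_pos (sub_pos.2 h)]
    exact this
  · simp [h]
  · have := hg y (x - y) (by linarith)
    rw [add_sub_cancel] at this
    rw [abs_of_pos (sub_pos.2 h)]
    exact this

theorem lip_K {g : ℝ → ℝ} {K : ℝ} (hg : ∀ x δ : ℝ, 0 < δ → |g (x + δ) - g x| ≤ K * δ) : 0 ≤ K := by
  have := (abs_nonneg _).trans (hg 0 1 one_pos)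
  linarith

theorem lip_cont {g : ℝ → ℝ} {K : ℝ} (hg : ∀ x δ : ℝ, 0 < δ → |g (x + δ) - g x| ≤ K * δ) :
    Continuous g := by
  have : LipschitzWith (Real.toNNReal K) g := LipschitzWith.of_dist_le_mul fun x y => by
    rw [Real.coe_toNNReal K (lip_K hg)]
    exact lip_abs hg x y
  exact this.continuous

theorem cont_memLp {f : ℝ → ℝ} (hf : Continuous f) (p : ℝ≥0∞) : MemLp f p perMeas := by
  obtain ⟨B, hB⟩ := (isCompact_Icc (a := (0:ℝ)) (b := 2*π)).exists_bound_of_continuousOn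
    hf.continuousOn
  exact MemLp.of_bound hf.aestronglyMeasurable B
    (ae_restrict_of_forall_mem measurableSet_Ioc fun x hx => hB x (Ioc_subset_Icc_self hx))

theorem lip_step {n : ℕ} (hn : 1 ≤ n) {g : ℝ → ℝ} {K : ℝ}
    (hg : ∀ x δ : ℝ, 0 < δ → |g (x + δ) - g x| ≤ K * δ) (x : ℝ) :
    |g x - stepF n g x| ≤ K * (2*π/n) := by
  refine (lip_abs hg _ _).trans (mul_le_mul_of_nonneg_left ?_ (lip_K hg))
  obtain ⟨h1, h2, h3⟩ := stepPt_bounds hn x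
  rw [abs_le]
  have : 0 < 2*π/(n:ℝ) := by have := Real.pi_pos; have : (0:ℝ) < n := (by exact_mod_cast hn); positivity
  constructor <;> linarith

theorem lp_le_bound {p : ℝ≥0∞} (hp1 : 1 ≤ p) (hpt : p ≠ ∞) {f : ℝ → ℝ} {B : ℝ} (hB : 0 ≤ B)
    (h : ∀ x, |f x| ≤ B) : LpNormPer p f ≤ 2*π*B := by
  have hpi := Real.pi_gt_three
  have hq : 1 ≤ p.toReal := by
    have := ENNReal.toReal_mono hpt hp1
    simpa [cosLp] using this
  have := eLpNorm_le_of_ae_bound (p := p) (μ := perMeas) (f := f) (C := B)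
      (Filter.Eventually.of_forall h)
  have h2 := ENNReal.toReal_mono (by
      refine ENNReal.mul_ne_top ?_ ENNReal.ofReal_ne_top
      exact ENNReal.rpow_ne_top_of_nonneg (by positivity) (measure_ne_top _ _)) this
  refine h2.trans ?_
  rw [ENNReal.toReal_mul, ENNReal.toReal_ofReal hB, ← ENNReal.toReal_rpow]
  refine mul_le_mul_of_nonneg_right ?_ hB
  have e : (perMeas univ).toReal = 2*π := by
    simp [ENNReal.toReal_ofReal, Real.pi_pos.le]
  rw [e]
  calc (2*π) ^ p.toReal⁻¹ ≤ (2*π) ^ (1:ℝ) :=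
        rpow_le_rpow_of_exponent_le (by linarith) (inv_le_one_of_one_le₀ hq)
    _ = 2*π := rpow_one _

theorem bv_memLp {g : ℝ → ℝ} (hg : BoundedVariationOn g (Icc (0:ℝ) (2*π))) :
    MemLp g 1 perMeas := by
  obtain ⟨a, b, ha, hb, hab⟩ := hg.locallyBoundedVariationOn.exists_monotoneOn_sub_monotoneOn
  have hm : AEMeasurable g perMeas := by
    rw [hab]
    exact (aemeasurable_restrict_of_monotoneOn measurableSet_Ioc (ha.mono Ioc_subset_Icc_self)).sub
      (aemeasurable_restrict_of_monotoneOn measurableSet_Ioc (hb.mono Ioc_subset_Icc_self))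
  refine MemLp.of_bound hm.aestronglyMeasurable
    (|g 0| + (eVariationOn g (Icc (0:ℝ) (2*π))).toReal)
    (ae_restrict_of_forall_mem measurableSet_Ioc fun x hx => ?_)
  have hpi := Real.pi_pos
  have := hg.dist_le (Ioc_subset_Icc_self hx) (show (0:ℝ) ∈ Icc 0 (2*π) from ⟨le_rfl, by positivity⟩)
  rw [Real.dist_eq] at this
  rw [Real.norm_eq_abs]
  have h2 := abs_sub_abs_le_abs_sub (g x) (g 0)
  linarith

theorem var_shift {g : ℝ → ℝ} (hg : ∀ t : ℝ, g (t + 2*π) = g t) :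
    eVariationOn g (Icc (0:ℝ) (2*π)) = eVariationOn g (Icc (-π) π) := by
  have hpi := Real.pi_pos
  have h1 := eVariationOn.Icc_add_Icc g (s := univ) (a := -π) (b := 0) (c := π)
    (by linarith) hpi.le (mem_univ _)
  have h2 := eVariationOn.Icc_add_Icc g (s := univ) (a := 0) (b := π) (c := 2*π)
    hpi.le (by linarith) (mem_univ _)
  simp only [univ_inter] at h1 h2
  have h3 := eVariationOn.comp_eq_of_monotoneOn g (t := Icc (-π) 0) (fun x => x + 2*π)
    (fun x _ y _ hxy => by simpa using hxy)
  have e : g ∘ (fun x => x + 2*π) = g := funext hg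
  rw [e, image_add_const_Icc] at h3
  have e2 : -π + 2*π = π := by ring
  rw [e2, zero_add] at h3
  rw [← h1, ← h2, h3, add_comm]

theorem bv_step {n : ℕ} (hn : 1 ≤ n) {g : ℝ → ℝ} (hg : BoundedVariationOn g (Icc (0:ℝ) (2*π))) :
    LpNormPer 1 (fun x => |g x - stepF n g x|) ≤
      2*π/n * (eVariationOn g (Icc (0:ℝ) (2*π))).toReal := by
  have hn' : (0:ℝ) < n := by exact_mod_cast hn
  have hpi := Real.pi_pos
  set s := Icc (0:ℝ) (2*π) with hs
  have hl := hg.locallyBoundedVariationOn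
  have h0 : (0:ℝ) ∈ s := ⟨le_rfl, by positivity⟩
  set W := variationOnFromTo g s 0 with hW
  have hmono : MonotoneOn W s := variationOnFromTo.monotoneOn hl h0
  have hd : ∀ x ∈ s, ∀ y ∈ s, x ≤ y → |g x - g y| ≤ W y - W x := by
    intro x hx y hy hxy
    have h1 := variationOnFromTo.add hl h0 hx hy
    have h2 := variationOnFromTo.eq_of_le g s hxy
    have h3 := (hg.mono (inter_subset_left : s ∩ Icc x y ⊆ s)).dist_le (x := x) (y := y)
      ⟨hx, le_rfl, hxy⟩ ⟨hy, hxy, le_rfl⟩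
    rw [Real.dist_eq] at h3
    linarith
  set w : ℤ → ℝ := fun k => W (stepPt n k) - W (stepPt n (k-1)) with hw
  have m := step_memLp hn (p := 1) le_rfl ENNReal.one_ne_top w
  have hle : LpNormPer 1 (fun x => |g x - stepF n g x|) ≤ LpNormPer 1 (fun x => w (stepIdx n x)) := by
    refine lp_mono m fun x hx => ?_
    obtain ⟨b1, b2, b3⟩ := stepPt_bounds hn x
    obtain ⟨b4, b5⟩ := stepPt_mem hn hx
    have i1 : stepPt n (stepIdx n x - 1) ∈ s := ⟨b4, by linarith⟩
    have i2 : stepPt n (stepIdx n x) ∈ s := ⟨by linarith, b5⟩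
    have i3 : x ∈ s := Ioc_subset_Icc_self hx
    have := hd x i3 _ i2 b1
    have h4 := hmono i1 i3 b2.le
    rw [abs_abs]
    simp only [hw, stepF]
    linarith
  refine hle.trans ?_
  rw [lp_eq le_rfl ENNReal.one_ne_top m]
  simp only [ENNReal.toReal_one, rpow_one, inv_one]
  rw [(step_integral hn (fun k _ => |w k|) (fun _ => continuous_const) (fun k t => rfl)).2]
  have hpt : ∀ k : ℕ, k ≤ n → stepPt n k ∈ s := by
    intro k hk
    have : (k:ℝ) ≤ n := by exact_mod_cast hk
    unfold stepPt
    refine ⟨by push_cast; positivity, ?_⟩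
    push_cast
    rw [div_mul_eq_mul_div, div_le_iff₀ hn']; nlinarith
  have hsum : ∀ k ∈ Finset.range n, ∫ t in (0:ℝ)..(2*π), |w ((k:ℤ)+1)| =
      2*π * (W (stepPt n ((k+1:ℕ):ℤ)) - W (stepPt n (k:ℤ))) := by
    intro k hk
    have hk' := Finset.mem_range.1 hk
    rw [intervalIntegral.integral_const]
    have e : w ((k:ℤ)+1) = W (stepPt n ((k+1:ℕ):ℤ)) - W (stepPt n (k:ℤ)) := by
      simp [hw]
    rw [e, abs_of_nonneg]
    · simp
    · refine sub_nonneg.2 (hmono (hpt k hk'.le) (hpt (k+1) hk') ?_)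
      unfold stepPt
      push_cast
      gcongr
      linarith
  rw [Finset.sum_congr rfl hsum, ← Finset.mul_sum,
    Finset.sum_range_sub (fun k : ℕ => W (stepPt n (k:ℤ)))]
  have e0 : stepPt n ((0:ℕ):ℤ) = 0 := by simp [stepPt]
  have en : stepPt n (n:ℤ) = 2*π := by
    simp only [stepPt, Int.cast_natCast]; field_simp
  rw [e0, en, hW, variationOnFromTo.self, sub_zero,
    variationOnFromTo.eq_of_le g s (by positivity), inter_self]
  apply le_of_eq
  ring

theorem lpInf_ge {f : ℝ → ℝ} (hf : Continuous f) {x : ℝ} (hx : x ∈ Icc 0 (2*π)) :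
    |f x| ≤ LpNormPer ∞ f := by
  have hpi := Real.pi_pos
  have hm := cont_memLp hf ∞
  have h1 : ∀ᵐ y ∂perMeas, |f y| ≤ LpNormPer ∞ f := by
    have := ae_le_eLpNormEssSup (f := f) (μ := perMeas)
    filter_upwards [this] with y hy
    unfold LpNormPer
    rw [eLpNorm_exponent_top]
    have h3 := ENNReal.toReal_mono (by rw [← eLpNorm_exponent_top]; exact hm.2.ne) hy
    simpa using h3
  have h2 : (fun y => max |f y| (LpNormPer ∞ f)) =ᵐ[volume.restrict (Icc 0 (2*π))]
      fun _ => LpNormPer ∞ f := by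
    rw [← restrict_Ioc_eq_restrict_Icc]
    filter_upwards [h1] with y hy
    exact max_eq_right hy
  have h3 := Measure.eqOn_Icc_of_ae_eq volume (by positivity) h2
    (by fun_prop) (by fun_prop) hx
  simp only at h3
  rw [← h3]
  exact le_max_left _ _

theorem lpInf_le {f : ℝ → ℝ} {B : ℝ} (hB : 0 ≤ B) (h : ∀ x ∈ Ioc 0 (2*π), |f x| ≤ B) :
    LpNormPer ∞ f ≤ B := by
  have := eLpNorm_le_of_ae_bound (p := ∞) (μ := perMeas) (f := f) (C := B)
      (ae_restrict_of_forall_mem measurableSet_Ioc h)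
  have h2 := ENNReal.toReal_mono (by simp) this
  simpa [hB, LpNormPer] using h2

theorem cosLp_inf : cosLp ∞ = 1 := by
  have hpi := Real.pi_pos
  apply le_antisymm
  · exact lpInf_le zero_le_one fun x _ => abs_cos_le_one x
  · have := lpInf_ge continuous_cos (x := 0) ⟨le_rfl, by positivity⟩
    simpa [cosLp] using this

theorem r_pointwise {n : ℕ} (hn : 1 ≤ n) {g h : ℝ → ℝ} {K : ℝ}
    (hg : ∀ x δ : ℝ, 0 < δ → |g (x + δ) - g x| ≤ K * δ)
    (hh : ∀ x δ : ℝ, 0 < δ → |h (x + δ) - h x| ≤ K * δ) (α : ℝ) {x : ℝ} (hx : x ∈ Ioc 0 (2*π))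
    {s : ℝ} (hs : ∃ θ, cos θ = s) : ∃ y ∈ Icc 0 (2*π),
      |g y * cos (n*y+α) + h y * sin (n*y+α) - rGH g h x * s| ≤ 4*π*K/n := by
  have hn' : (0:ℝ) < n := by exact_mod_cast hn
  have hpi := Real.pi_pos
  obtain ⟨θ, hθ⟩ := hs
  obtain ⟨β, hβ⟩ := amp' (g x) (h x) α
  obtain ⟨b1, b2, b3⟩ := stepPt_bounds hn x
  obtain ⟨b4, b5⟩ := stepPt_mem hn hx
  set a := stepPt n (stepIdx n x - 1)
  have hper : Function.Periodic (fun t => cos (t + β)) (2*π) := by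
    intro t
    have : t + 2*π + β = t + β + 2*π := by ring
    simp only [this, cos_add_two_pi]
  obtain ⟨t, ⟨ht1, ht2⟩, ht⟩ := hper.exists_mem_Ico (by positivity) (θ - β) (n * a)
  simp only [sub_add_cancel, hθ] at ht
  have hy1 : a ≤ t / n := by rw [le_div_iff₀ hn']; linarith
  have hy2 : t / n ≤ a + 2*π/n := by
    rw [div_le_iff₀ hn', add_mul, div_mul_cancel₀ _ hn'.ne']; linarith
  refine ⟨t/n, ⟨by linarith, by linarith⟩, ?_⟩
  have e : (n:ℝ) * (t/n) = t := by field_simp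
  rw [e, ht]
  have e2 : rGH g h x * cos (t + β) = g x * cos (t+α) + h x * sin (t+α) := (hβ t).symm
  rw [e2]
  have e3 : g (t/n) * cos (t+α) + h (t/n) * sin (t+α) - (g x * cos (t+α) + h x * sin (t+α)) =
    (g (t/n) - g x) * cos (t+α) + (h (t/n) - h x) * sin (t+α) := by ring
  rw [e3]
  refine (trig_lip _ _ _ _ (abs_cos_le_one _) (abs_sin_le_one _)).trans ?_
  have hd : |t/n - x| ≤ 2*π/n := by
    rw [abs_le]; constructor <;> linarith
  have g1 := (lip_abs hg (t/n) x).trans (mul_le_mul_of_nonneg_left hd (lip_K hg))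
  have g2 := (lip_abs hh (t/n) x).trans (mul_le_mul_of_nonneg_left hd (lip_K hg))
  have e4 : 4*π*K/n = K*(2*π/n) + K*(2*π/n) := by ring
  rw [e4]
  linarith

theorem main_inf {n : ℕ} (hn : 1 ≤ n) {g h : ℝ → ℝ} {K : ℝ}
    (hg : ∀ x δ : ℝ, 0 < δ → |g (x + δ) - g x| ≤ K * δ)
    (hh : ∀ x δ : ℝ, 0 < δ → |h (x + δ) - h x| ≤ K * δ) (α : ℝ) :
    |(⨅ c : ℝ, LpNormPer ∞
          (fun x => g x * Real.cos ((n:ℝ)*x + α) + h x * Real.sin ((n:ℝ)*x + α) - c)) -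
        LpNormPer ∞ (rGH g h)| ≤ 4*π*K/n := by
  have hpi := Real.pi_pos
  have hK := lip_K hg
  have cg := lip_cont hg
  have ch := lip_cont hh
  have cr : Continuous (rGH g h) := by unfold rGH; fun_prop
  have hE : 0 ≤ 4*π*K/n := by positivity
  have lo : LpNormPer ∞ (rGH g h) - 4*π*K/n ≤ ⨅ c : ℝ, LpNormPer ∞
      (fun x => g x * cos (n*x+α) + h x * sin (n*x+α) - c) := by
    apply le_ciInf
    intro c
    have cΦ : Continuous (fun x => g x * cos (n*x+α) + h x * sin (n*x+α) - c) := by fun_prop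
    rw [sub_le_iff_le_add]
    refine lpInf_le (add_nonneg (lp_nonneg _ _) hE) fun x hx => ?_
    rw [abs_of_nonneg (show 0 ≤ rGH g h x from sqrt_nonneg _)]
    obtain ⟨y, hy, h1⟩ := r_pointwise hn hg hh α hx (s := 1) ⟨0, cos_zero⟩
    obtain ⟨z, hz, h2⟩ := r_pointwise hn hg hh α hx (s := -1) ⟨π, cos_pi⟩
    have h3 := lpInf_ge cΦ hy
    have h4 := lpInf_ge cΦ hz
    rw [abs_le] at h1 h2 h3 h4
    linarith [h1.1, h2.2, h3.2, h4.1]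
  have hi : (⨅ c : ℝ, LpNormPer ∞
      (fun x => g x * cos (n*x+α) + h x * sin (n*x+α) - c)) ≤ LpNormPer ∞ (rGH g h) := by
    refine (ciInf_le ⟨0, ?_⟩ 0).trans ?_
    · rintro _ ⟨c, rfl⟩
      exact lp_nonneg _ _
    · refine lp_mono (cont_memLp cr ∞) fun x _ => ?_
      obtain ⟨β, hβ⟩ := amp' (g x) (h x) α
      rw [sub_zero, hβ, abs_mul, abs_of_nonneg (sqrt_nonneg _)]
      exact mul_le_of_le_one_right (sqrt_nonneg _) (abs_cos_le_one _)
  rw [abs_le]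
  constructor <;> linarith

/-- **Lemma 1, second formula (28).** For `Φ(x) = g(x)cos(nx+α) + h(x)sin(nx+α)`:
`|inf_{c∈ℝ}‖Φ − c‖_p − (2π)^{−1/p}‖cos‖_p‖r‖_p| ≤ C·M/n`. -/
theorem statement8 :
    ∃ C : ℝ, 0 < C ∧ ∀ (p : ℝ≥0∞), 1 ≤ p → ∀ (g h : ℝ → ℝ) (K : ℝ),
      (∀ t : ℝ, g (t + 2*π) = g t) → (∀ t : ℝ, h (t + 2*π) = h t) →
      (p = 1 → BoundedVariationOn g (Icc (0:ℝ) (2*π)) ∧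
               BoundedVariationOn h (Icc (0:ℝ) (2*π))) →
      (1 < p → (∀ x δ : ℝ, 0 < δ → |g (x + δ) - g x| ≤ K * δ) ∧
               (∀ x δ : ℝ, 0 < δ → |h (x + δ) - h x| ≤ K * δ)) →
      ∀ (n : ℕ), 1 ≤ n → ∀ (α : ℝ),
        |(⨅ c : ℝ, LpNormPer p
              (fun x => g x * Real.cos ((n:ℝ)*x + α) + h x * Real.sin ((n:ℝ)*x + α) - c)) -
            (2*π) ^ (-(1/p.toReal)) * cosLp p * LpNormPer p (rGH g h)| ≤
          C * MLem p g h K / n := by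
  refine ⟨16*π^2, by have := Real.pi_pos; positivity, ?_⟩
  intro p hp1 g h K pg ph hbv hlip n hn α
  have hn' : (0:ℝ) < n := by exact_mod_cast hn
  have hpi := Real.pi_gt_three
  by_cases h1 : p = 1
  · subst h1
    obtain ⟨bg, bh⟩ := hbv rfl
    have mg := bv_memLp bg
    have mh := bv_memLp bh
    refine (main_finite hn le_rfl ENNReal.one_ne_top mg mh α).trans ?_
    have sg := bv_step hn bg
    have sh := bv_step hn bh
    have mG : MemLp (stepF n g) 1 perMeas :=
      step_memLp hn le_rfl ENNReal.one_ne_top (fun k => g (stepPt n k))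
    have mH : MemLp (stepF n h) 1 perMeas :=
      step_memLp hn le_rfl ENNReal.one_ne_top (fun k => h (stepPt n k))
    have m1 : MemLp (fun x => |g x - stepF n g x|) 1 perMeas := (mg.sub mG).norm
    have m2 : MemLp (fun x => |h x - stepF n h x|) 1 perMeas := (mh.sub mH).norm
    have tri := lp_tri (p := 1) le_rfl
      (f1 := fun x => |g x - stepF n g x| + |h x - stepF n h x|) m1 (m1.add m2) m2 (fun x => by
        rw [add_sub_cancel_left, abs_abs])
    rw [var_shift pg] at sg
    rw [var_shift ph] at sh
    simp only [MLem, if_true]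
    set V := (eVariationOn g (Icc (-π) π)).toReal
    set U := (eVariationOn h (Icc (-π) π)).toReal
    have hV : 0 ≤ V := ENNReal.toReal_nonneg
    have hU : 0 ≤ U := ENNReal.toReal_nonneg
    calc _ ≤ 2 * (2*π/n*V + 2*π/n*U) := by linarith
      _ = 4*π*((V+U)/n) := by ring
      _ ≤ 16*π^2*((V+U)/n) := by
        apply mul_le_mul_of_nonneg_right _ (by positivity)
        nlinarith
      _ = _ := by ring
  · have hp : 1 < p := lt_of_le_of_ne hp1 (Ne.symm h1)
    obtain ⟨lg, lh⟩ := hlip hp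
    have hK := lip_K lg
    by_cases h2 : p = ∞
    · subst h2
      have := main_inf hn lg lh α
      simp only [MLem, if_neg h1, if_true, ENNReal.toReal_top, div_zero, neg_zero, rpow_zero,
        cosLp_inf, one_mul]
      refine this.trans ?_
      rw [mul_div_assoc, mul_div_assoc]
      apply mul_le_mul_of_nonneg_right _ (by positivity)
      nlinarith
    · refine (main_finite hn hp1 h2 (cont_memLp (lip_cont lg) p) (cont_memLp (lip_cont lh) p)
        α).trans ?_
      have hb := lp_le_bound hp1 h2
        (f := fun x => |g x - stepF n g x| + |h x - stepF n h x|)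
        (B := K * (2*π/n) + K * (2*π/n)) (by positivity) (fun x => by
          rw [abs_of_nonneg (by positivity)]
          exact add_le_add (lip_step hn lg x) (lip_step hn lh x))
      have hM : K ≤ MLem p g h K := by
        simp only [MLem, if_neg h1, if_neg h2]
        refine le_add_of_nonneg_right ?_
        have := lp_nonneg p (rGH g h)
        positivity
      calc _ ≤ 2 * (2*π*(K * (2*π/n) + K * (2*π/n))) := by linarith
        _ = 16*π^2*K/n := by ring
        _ ≤ _ := by gcongr
end

section
/- There exists an absolute constant C > 0 with the following property. Let 1 ≤ p ≤ ∞ and let g, h be 2π-periodic functions that are of bounded variation on [0,2π] if p = 1, or satisfy the Lipschitz condition |f(x+δ) − f(x)| ≤ Kδ for all x ∈ ℝ, δ > 0 (with constant K) if 1 < p ≤ ∞. For n ∈ ℕ and α ∈ ℝ set Φ(x) = g(x)cos(nx+α) + h(x)sin(nx+α) and r(x) = √(g(x)² + h(x)²). Then | sup_{θ ∈ ℝ} (1/2)‖Φ(·+θ) − Φ(·)‖_p − (2π)^{−1/p} ‖cos t‖_p ‖r‖_p | ≤ C M/n, where M = V_{−π}^{π}(g) + V_{−π}^{π}(h) if p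 = 1, M = K + p^{−1} ‖r‖_p^{1−p} V_{−π}^{π}(r^p) if 1 < p < ∞, and M = K if p = ∞ (V denoting total variation). -/
open MeasureTheory Real Set
open scoped ENNReal

/-- variation is invariant under shifting by a period. -/
lemma aux_var_shift {g : ℝ → ℝ} {c : ℝ} (hg : ∀ t, g (t + c) = g t) (a b : ℝ) :
    eVariationOn g (Icc (a + c) (b + c)) = eVariationOn g (Icc a b) := by
  have h := eVariationOn.comp_eq_of_monotoneOn g (t := Icc a b) (fun x => x + c)
    (fun x _ y _ hxy => by simpa using hxy)
  rw [image_add_const_Icc] at h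
  rw [← h]
  congr 1
  funext t
  exact (hg t)

lemma aux_var_sum {g : ℝ → ℝ} (hg : ∀ t : ℝ, g (t + 2*π) = g t) (k N : ℕ) :
    eVariationOn g (Icc (-π - k * (2*π)) (-π - k * (2*π) + N * (2*π)))
      = N * eVariationOn g (Icc (-π) π) := by
  have hp : Function.Periodic g (2*π) := hg
  have hm : Monotone (fun i : ℕ => -π - k * (2*π) + i * (2*π)) := by
    intro i j hij
    have : (i:ℝ) ≤ j := by exact_mod_cast hij
    have := pi_pos
    simp only
    gcongr
  have h := eVariationOn.sum' g hm (n := N)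
  simp only [Nat.cast_zero, zero_mul, add_zero] at h
  rw [← h]
  rw [Finset.sum_congr rfl (g := fun _ => eVariationOn g (Icc (-π) π))]
  · simp
  · intro i _
    have h2 : ∀ t, g (t + ((i:ℤ) - (k:ℤ) : ℤ) * (2*π)) = g t := by
      intro t
      exact (hp.int_mul _) t
    rw [← aux_var_shift h2 (-π) π]
    congr 2 <;> push_cast <;> ring

lemma aux_bv_fin {g : ℝ → ℝ} (hg : ∀ t : ℝ, g (t + 2*π) = g t)
    (hb : BoundedVariationOn g (Icc (0:ℝ) (2*π))) : eVariationOn g (Icc (-π) π) ≠ ∞ := by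
  have hpi := pi_pos
  have h := eVariationOn.Icc_add_Icc g (s := univ) (a := -π) (b := 0) (c := π)
    (by linarith) (by linarith) (mem_univ _)
  simp only [univ_inter] at h
  rw [← h]
  have h1 := aux_var_shift hg (-π) 0
  rw [← h1]
  refine ENNReal.add_ne_top.2 ⟨?_, ?_⟩
  · exact ne_top_of_le_ne_top hb (eVariationOn.mono _ (Icc_subset_Icc (by linarith) (by linarith)))
  · exact ne_top_of_le_ne_top hb (eVariationOn.mono _ (Icc_subset_Icc (by linarith) (by linarith)))

lemma aux_lbv {g : ℝ → ℝ} (hg : ∀ t : ℝ, g (t + 2*π) = g t)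
    (hb : BoundedVariationOn g (Icc (0:ℝ) (2*π))) : LocallyBoundedVariationOn g univ := by
  intro a b _ _
  have hpi := pi_pos
  obtain ⟨k, hk⟩ := exists_nat_ge ((|a| + |b|) / (2*π))
  rw [div_le_iff₀ (by positivity)] at hk
  have h := aux_var_sum hg k (2 * k + 1)
  unfold BoundedVariationOn
  refine ne_top_of_le_ne_top (b := ((2*k+1 : ℕ):ℝ≥0∞) * eVariationOn g (Icc (-π) π)) ?_ ?_
  · exact ENNReal.mul_ne_top (ENNReal.natCast_ne_top _) (aux_bv_fin hg hb)
  · rw [← h, univ_inter]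
    apply eVariationOn.mono
    push_cast
    apply Icc_subset_Icc
    · have := neg_abs_le a
      have := abs_nonneg b
      linarith
    · have := le_abs_self b
      have := abs_nonneg a
      linarith

lemma aux_bv_meas {g : ℝ → ℝ} (hl : LocallyBoundedVariationOn g univ) : Measurable g := by
  obtain ⟨p, q, hp, hq, rfl⟩ := hl.exists_monotoneOn_sub_monotoneOn
  exact (monotoneOn_univ.1 hp).measurable.sub (monotoneOn_univ.1 hq).measurable

lemma aux_bv_bdd {g : ℝ → ℝ} (hg : ∀ t : ℝ, g (t + 2*π) = g t)
    (hb : BoundedVariationOn g (Icc (0:ℝ) (2*π))) : ∃ B, ∀ x, |g x| ≤ B := by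
  have hpi := pi_pos
  refine ⟨|g 0| + (eVariationOn g (Icc (0:ℝ) (2*π))).toReal, fun x => ?_⟩
  obtain ⟨y, hy, hxy⟩ := (show Function.Periodic g (2*π) from hg).exists_mem_Ico₀ (by positivity) x
  rw [hxy]
  have := hb.dist_le (Ico_subset_Icc_self hy) (left_mem_Icc.2 (by positivity : (0:ℝ) ≤ 2*π))
  rw [Real.dist_eq] at this
  have := abs_sub_abs_le_abs_sub (g y) (g 0)
  linarith

lemma aux_bv_shift {g : ℝ → ℝ} (hg : ∀ t : ℝ, g (t + 2*π) = g t)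
    (hb : BoundedVariationOn g (Icc (0:ℝ) (2*π))) {δ : ℝ} (h0 : 0 ≤ δ) (h1 : δ ≤ 2*π) :
    eLpNorm (fun x => g (x + δ) - g x) 1 (volume.restrict (Ioc (0:ℝ) (2*π)))
      ≤ ENNReal.ofReal (δ * (3 * (eVariationOn g (Icc (-π) π)).toReal)) := by
  have hpi := pi_pos
  have hl := aux_lbv hg hb
  set v := variationOnFromTo g univ 0 with hv
  have hvm : Monotone v := monotoneOn_univ.1 (variationOnFromTo.monotoneOn hl (mem_univ 0))
  have hvi : ∀ a b, IntervalIntegrable v volume a b := fun a b => hvm.intervalIntegrable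
  have hvi2 : ∀ c a b, IntervalIntegrable (fun x => v (x + c)) volume a b := fun c a b =>
    Monotone.intervalIntegrable (fun x y hxy => hvm (by linarith))
  have hdiff : ∀ x c, 0 ≤ c → v (x + c) - v x = (eVariationOn g (Icc x (x+c))).toReal := by
    intro x c hc
    have h := variationOnFromTo.add hl (mem_univ 0) (mem_univ x) (mem_univ (x+c))
    have h' := variationOnFromTo.eq_of_le g univ (show x ≤ x + c by linarith)
    rw [univ_inter] at h'
    rw [← h', hv]; linarith
  have hle : ∀ x, |g (x + δ) - g x| ≤ v (x + δ) - v x := by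
    intro x
    rw [hdiff x δ h0]
    have hbv : BoundedVariationOn g (Icc x (x+δ)) := by
      have := hl x (x+δ) (mem_univ _) (mem_univ _)
      rwa [univ_inter] at this
    exact hbv.dist_le (right_mem_Icc.2 (by linarith)) (left_mem_Icc.2 (by linarith))
  have h3 : ∀ x ∈ Icc 0 δ, v (x + 2*π) - v x ≤ 3 * (eVariationOn g (Icc (-π) π)).toReal := by
    intro x hx
    rw [hdiff x _ (by positivity)]
    have h := aux_var_sum hg 0 3
    have h' : eVariationOn g (Icc x (x + 2*π)) ≤ 3 * eVariationOn g (Icc (-π) π) := by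
      refine le_trans (eVariationOn.mono _ ?_) (le_of_eq h)
      apply Icc_subset_Icc
      · have := hx.1; push_cast; linarith
      · have := hx.2; push_cast; linarith
    have h'' := ENNReal.toReal_mono (ENNReal.mul_ne_top (by norm_num) (aux_bv_fin hg hb)) h'
    simpa using h''
  have h_int : ∫ x in (0:ℝ)..(2*π), (v (x + δ) - v x) = ∫ x in (0:ℝ)..δ, (v (x + 2*π) - v x) := by
    rw [intervalIntegral.integral_sub (hvi2 _ _ _) (hvi _ _),
      intervalIntegral.integral_sub (hvi2 _ _ _) (hvi _ _),
      intervalIntegral.integral_comp_add_right, intervalIntegral.integral_comp_add_right]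
    have e1 := intervalIntegral.integral_add_adjacent_intervals (hvi 0 δ) (hvi δ (2*π + δ))
    have e2 := intervalIntegral.integral_add_adjacent_intervals (hvi 0 (2*π)) (hvi (2*π) (2*π + δ))
    simp only [zero_add]
    rw [add_comm δ (2*π)]
    linarith
  have hbd : ∫ x in (0:ℝ)..δ, (v (x + 2*π) - v x) ≤ δ * (3 * (eVariationOn g (Icc (-π) π)).toReal) := by
    have := intervalIntegral.integral_mono_on h0 ((hvi2 (2*π) 0 δ).sub (hvi 0 δ))
      (intervalIntegrable_const (c := 3 * (eVariationOn g (Icc (-π) π)).toReal)) h3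
    rw [intervalIntegral.integral_const, smul_eq_mul, sub_zero] at this
    exact this
  rw [eLpNorm_one_eq_lintegral_enorm]
  calc ∫⁻ x in Ioc (0:ℝ) (2*π), ‖g (x + δ) - g x‖ₑ
      ≤ ∫⁻ x in Ioc (0:ℝ) (2*π), ENNReal.ofReal (v (x + δ) - v x) := by
        apply lintegral_mono
        intro x
        simp only
        rw [← ofReal_norm]
        exact ENNReal.ofReal_le_ofReal (hle x)
    _ = ENNReal.ofReal (∫ x in Ioc (0:ℝ) (2*π), (v (x + δ) - v x)) := by
        rw [ofReal_integral_eq_lintegral_ofReal]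
        · have := ((hvi2 δ 0 (2*π)).sub (hvi 0 (2*π))).1
          exact this
        · exact Filter.Eventually.of_forall fun x => le_trans (abs_nonneg _) (hle x)
    _ ≤ _ := by
        apply ENNReal.ofReal_le_ofReal
        rw [← intervalIntegral.integral_of_le (by positivity), h_int]
        exact hbd

/-- measure on one period -/
noncomputable abbrev muP : Measure ℝ := volume.restrict (Ioc (0:ℝ) (2*π))

lemma aux_shift_norm {f : ℝ → ℝ} (hf : Measurable f) (hp : ∀ t : ℝ, f (t + 2*π) = f t)
    (p : ℝ≥0∞) (δ : ℝ) : eLpNorm (fun x => f (x + δ)) p muP = eLpNorm f p muP := by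
  have : Fact (0 < 2*π) := ⟨by positivity⟩
  have key : ∀ F : ℝ → ℝ, Measurable F → (∀ t : ℝ, F (t + 2*π) = F t) → ∀ a,
      eLpNorm F p (volume.restrict (Ioc a (a + 2*π))) = eLpNorm F p muP := by
    intro F hF hFp a
    have hper : Function.Periodic F (2*π) := hFp
    let G : AddCircle (2*π) → ℝ := fun u => F (AddCircle.measurableEquivIoc (2*π) 0 u)
    have hG : Measurable G :=
      hF.comp (measurable_subtype_coe.comp (AddCircle.measurableEquivIoc (2*π) 0).measurable)
    have hGF : G ∘ (QuotientAddGroup.mk : ℝ → AddCircle (2*π)) = F := by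
      funext x
      show F (toIocMod _ 0 x) = F x
      rw [toIocMod, hper.sub_zsmul_eq]
    have h := fun b => eLpNorm_comp_measurePreserving (p := p) hG.aestronglyMeasurable
      (AddCircle.measurePreserving_mk (2*π) b)
    rw [hGF] at h
    rw [h a, muP, ← h 0, zero_add]
  have h1 : MeasurePreserving (fun x : ℝ => x + δ) muP
      (volume.restrict (Ioc δ (δ + 2*π))) := by
    have := (measurePreserving_add_right (volume : Measure ℝ) δ).restrict_preimage
      (s := Ioc δ (δ + 2*π)) measurableSet_Ioc
    have hs : (fun x : ℝ => x + δ) ⁻¹' Ioc δ (δ + 2*π) = Ioc (0:ℝ) (2*π) := by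
      ext x
      simp only [mem_preimage, mem_Ioc]
      constructor <;> rintro ⟨h1, h2⟩ <;> constructor <;> linarith
    rw [hs] at this
    exact this
  rw [← key f hf hp δ, ← eLpNorm_comp_measurePreserving hf.aestronglyMeasurable h1]
  rfl

lemma aux_polar (a b : ℝ) : ∃ φ, ∀ y, a * cos y + b * sin y = √(a^2 + b^2) * cos (y + φ) := by
  refine ⟨-Complex.arg ⟨a, b⟩, fun y => ?_⟩
  have hn : ‖(⟨a, b⟩ : ℂ)‖ = √(a^2 + b^2) := by
    rw [Complex.norm_def, Complex.normSq_mk]; ring_nf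
  have h1 := Complex.norm_mul_cos_arg ⟨a, b⟩
  have h2 := Complex.norm_mul_sin_arg ⟨a, b⟩
  rw [hn] at h1 h2
  simp only at h1 h2
  rw [← sub_eq_add_neg, cos_sub]
  linear_combination (-cos y) * h1 - sin y * h2

/-- the function with phase β -/
noncomputable def Phi (g h : ℝ → ℝ) (n : ℕ) (β x : ℝ) : ℝ :=
  g x * cos (n * x + β) + h x * sin (n * x + β)

lemma aux_phi_meas {g h : ℝ → ℝ} (hg : Measurable g) (hh : Measurable h) (n : ℕ) (β : ℝ) :
    Measurable (Phi g h n β) := by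
  unfold Phi; fun_prop

lemma aux_phi_per {g h : ℝ → ℝ} (hg : ∀ t : ℝ, g (t + 2*π) = g t)
    (hh : ∀ t : ℝ, h (t + 2*π) = h t) (n : ℕ) (β t : ℝ) :
    Phi g h n β (t + 2*π) = Phi g h n β t := by
  unfold Phi
  rw [hg, hh, show (n:ℝ) * (t + 2*π) + β = (n * t + β) + n * (2*π) by ring,
    cos_add_nat_mul_two_pi, sin_add_nat_mul_two_pi]

lemma aux_phi_le (g h : ℝ → ℝ) (n : ℕ) (β x : ℝ) : |Phi g h n β x| ≤ rGH g h x := by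
  obtain ⟨φ, hφ⟩ := aux_polar (g x) (h x)
  unfold Phi rGH
  rw [hφ, abs_mul, abs_of_nonneg (sqrt_nonneg _)]
  exact mul_le_of_le_one_right (sqrt_nonneg _) (abs_cos_le_one _)

lemma aux_cos_top : eLpNorm Real.cos ∞ muP = 1 := by
  have hpi := pi_pos
  rw [eLpNorm_exponent_top]
  apply le_antisymm
  · apply eLpNormEssSup_le_of_ae_enorm_bound
    refine Filter.Eventually.of_forall fun x => ?_
    rw [← ofReal_norm, ← ENNReal.ofReal_one]
    exact ENNReal.ofReal_le_ofReal (abs_cos_le_one x)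
  · by_contra! hc
    have hae := ae_le_eLpNormEssSup (f := Real.cos) (μ := muP)
    set c := eLpNormEssSup Real.cos muP
    have hct : c ≠ ∞ := ne_top_of_lt hc
    have hc' : c.toReal < cos (2*π) := by
      rw [cos_two_pi]
      simpa using (ENNReal.toReal_lt_toReal hct ENNReal.one_ne_top).2 hc
    have hev : ∀ᶠ x in nhds (2*π), c.toReal < cos x :=
      (continuous_cos.tendsto (2*π)).eventually_const_lt hc'
    obtain ⟨ε, hε, hball⟩ := Metric.eventually_nhds_iff.1 hev
    rw [ae_restrict_iff' measurableSet_Ioc] at hae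
    have hsub : Ioo (max 0 (2*π - ε)) (2*π) ⊆ {x | ¬ (x ∈ Ioc (0:ℝ) (2*π) → ‖cos x‖ₑ ≤ c)} := by
      intro x hx
      have hx1 := (max_lt_iff.1 hx.1)
      simp only [mem_ofPred_eq, Classical.not_imp, not_le]
      refine ⟨⟨hx1.1, hx.2.le⟩, ?_⟩
      have := @hball x (by rw [Real.dist_eq, abs_lt]; constructor <;> linarith [hx.2, hx1.2])
      rw [← ofReal_norm, ENNReal.lt_ofReal_iff_toReal_lt hct]
      exact lt_of_lt_of_le this (le_abs_self _)
    have h0 := measure_mono_null hsub hae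
    rw [Real.volume_Ioo, ENNReal.ofReal_eq_zero] at h0
    have : max 0 (2*π - ε) < 2*π := max_lt (by positivity) (by linarith)
    linarith

/-- averaging over the phase, finite p -/
lemma aux_avg {g h : ℝ → ℝ} (hg : Measurable g) (hh : Measurable h) (n : ℕ) (α : ℝ)
    {p : ℝ≥0∞} (hp1 : 1 ≤ p) (hpt : p ≠ ∞) :
    ∫⁻ s, (eLpNorm (Phi g h n (α + s)) p muP) ^ p.toReal ∂muP
      = (eLpNorm Real.cos p muP * eLpNorm (rGH g h) p muP) ^ p.toReal := by
  have hp0 : p ≠ 0 := (zero_lt_one.trans_le hp1).ne'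
  have hpr : 0 < p.toReal := ENNReal.toReal_pos hp0 hpt
  have hpow : ∀ f : ℝ → ℝ, (eLpNorm f p muP) ^ p.toReal = ∫⁻ x, ‖f x‖ₑ ^ p.toReal ∂muP := by
    intro f
    rw [eLpNorm_eq_lintegral_rpow_enorm_toReal hp0 hpt, ← ENNReal.rpow_mul,
      one_div_mul_cancel hpr.ne', ENNReal.rpow_one]
  simp_rw [hpow]
  rw [lintegral_lintegral_swap]
  · have hx : ∀ x, ∫⁻ s, ‖Phi g h n (α + s) x‖ₑ ^ p.toReal ∂muP
        = (eLpNorm Real.cos p muP) ^ p.toReal * ‖rGH g h x‖ₑ ^ p.toReal := by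
      intro x
      rw [← hpow (fun s => Phi g h n (α + s) x)]
      obtain ⟨φ, hφ⟩ := aux_polar (g x) (h x)
      have : (fun s => Phi g h n (α + s) x)
          = (rGH g h x) • (fun s => cos (s + (n * x + α + φ))) := by
        funext s
        simp only [Phi, hφ, rGH, Pi.smul_apply, smul_eq_mul]
        congr 2; ring
      rw [this, eLpNorm_const_smul, aux_shift_norm measurable_cos cos_add_two_pi,
        ENNReal.mul_rpow_of_nonneg _ _ hpr.le, mul_comm]
    simp_rw [hx]
    rw [lintegral_const_mul, ENNReal.mul_rpow_of_nonneg _ _ hpr.le, hpow (rGH g h)]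
    unfold rGH
    fun_prop
  · apply Measurable.aemeasurable
    simp only [Function.uncurry_def, Phi]
    fun_prop

lemma aux_core_ennreal {g h : ℝ → ℝ} (hg : Measurable g) (hh : Measurable h) (n : ℕ) (α : ℝ)
    {p : ℝ≥0∞} (hp1 : 1 ≤ p) (a E : ℝ≥0∞)
    (haE : a = eLpNorm (Phi g h n α) p muP)
    (h1 : ∀ s ∈ Icc 0 (2*π), eLpNorm (Phi g h n (α + s)) p muP ≤ a + E)
    (h2 : ∀ s ∈ Icc 0 (2*π), a ≤ eLpNorm (Phi g h n (α + s)) p muP + E) :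
    ENNReal.ofReal ((2*π) ^ (-(1/p.toReal))) * eLpNorm Real.cos p muP * eLpNorm (rGH g h) p muP ≤ a + E ∧
    a ≤ ENNReal.ofReal ((2*π) ^ (-(1/p.toReal))) * eLpNorm Real.cos p muP * eLpNorm (rGH g h) p muP + E := by
  have hpi := pi_pos
  by_cases hpt : p = ∞
  · subst hpt
    rw [aux_cos_top]
    simp only [ENNReal.toReal_top, div_zero, neg_zero, rpow_zero, ENNReal.ofReal_one, one_mul]
    constructor
    · have hall : ∀ s : ℝ, eLpNorm (Phi g h n (α + s)) ∞ muP ≤ a + E := by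
        intro s
        have hper : Function.Periodic (fun s => Phi g h n (α + s)) (2*π) := by
          intro s
          funext x
          simp only [Phi]
          rw [show (n:ℝ) * x + (α + (s + 2*π)) = n * x + (α + s) + 2*π by ring, cos_add_two_pi,
            sin_add_two_pi]
        obtain ⟨y, hy, hxy⟩ := hper.exists_mem_Ico₀ (by positivity) s
        rw [hxy]
        exact h1 y (Ico_subset_Icc_self hy)
      rw [eLpNorm_exponent_top]
      apply eLpNormEssSup_le_of_ae_enorm_bound
      have hae : ∀ᵐ x ∂muP, ∀ q : ℚ, ‖Phi g h n (α + q) x‖ₑ ≤ a + E := by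
        rw [ae_all_iff]
        intro q
        have := ae_le_eLpNormEssSup (f := Phi g h n (α + q)) (μ := muP)
        filter_upwards [this] with x hx
        rw [← eLpNorm_exponent_top] at hx
        exact hx.trans (hall q)
      filter_upwards [hae] with x hx
      have hr : ∀ s : ℝ, ‖Phi g h n (α + s) x‖ₑ ≤ a + E := by
        intro s
        refine isClosed_property (p := fun s : ℝ => ‖Phi g h n (α + s) x‖ₑ ≤ a + E)
          Rat.denseRange_cast ?_ hx s
        refine isClosed_le ?_ continuous_const
        unfold Phi
        fun_prop
      obtain ⟨φ, hφ⟩ := aux_polar (g x) (h x)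
      have := hr (-(n * x + α + φ))
      unfold Phi at this
      rw [hφ, show (n:ℝ) * x + (α + -(n * x + α + φ)) + φ = 0 by ring, cos_zero, mul_one] at this
      exact this
    · rw [haE]
      refine le_trans (eLpNorm_mono fun x => ?_) le_self_add
      rw [Real.norm_eq_abs]
      exact (aux_phi_le g h n α x).trans (le_abs_self _)
  · have hp0 : p ≠ 0 := (zero_lt_one.trans_le hp1).ne'
    have hpr : 0 < p.toReal := ENNReal.toReal_pos hp0 hpt
    have havg := aux_avg hg hh n α hp1 hpt
    set T := eLpNorm Real.cos p muP * eLpNorm (rGH g h) p muP with hT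
    have hmu : muP univ = ENNReal.ofReal (2*π) := by simp [muP]
    have hw0 : ENNReal.ofReal (2*π) ≠ 0 := by simp [hpi]
    have hwt : ENNReal.ofReal (2*π) ≠ ∞ := ENNReal.ofReal_ne_top
    set w := ENNReal.ofReal (2*π) with hw
    have hww : ENNReal.ofReal ((2*π) ^ (-(1/p.toReal))) = w ^ (-(1/p.toReal)) := by
      rw [hw, ENNReal.ofReal_rpow_of_pos (by positivity)]
    rw [mul_assoc, ← hT, hww]
    have hwinv : w ^ (-(1/p.toReal)) * w ^ (1/p.toReal) = 1 := by
      rw [← ENNReal.rpow_add _ _ hw0 hwt]; simp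
    have hcon : ∀ c : ℝ≥0∞, (w ^ (1/p.toReal) * c) ^ p.toReal = ∫⁻ _, c ^ p.toReal ∂muP := by
      intro c
      rw [lintegral_const, hmu, ENNReal.mul_rpow_of_nonneg _ _ hpr.le, ← ENNReal.rpow_mul,
        one_div_mul_cancel hpr.ne', ENNReal.rpow_one, mul_comm]
    constructor
    · have : T ≤ w ^ (1/p.toReal) * (a + E) := by
        rw [← ENNReal.rpow_le_rpow_iff hpr, hcon, ← havg]
        apply setLIntegral_mono' measurableSet_Ioc
        intro s hs
        exact ENNReal.rpow_le_rpow (h1 s (Ioc_subset_Icc_self hs)) hpr.le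
      calc _ ≤ w ^ (-(1/p.toReal)) * (w ^ (1/p.toReal) * (a + E)) := by gcongr
        _ = _ := by rw [← mul_assoc, hwinv, one_mul]
    · have : w ^ (1/p.toReal) * (a - E) ≤ T := by
        rw [← ENNReal.rpow_le_rpow_iff hpr, hcon, ← havg]
        apply setLIntegral_mono' measurableSet_Ioc
        intro s hs
        exact ENNReal.rpow_le_rpow (tsub_le_iff_right.2 (h2 s (Ioc_subset_Icc_self hs))) hpr.le
      rw [← tsub_le_iff_right]
      calc a - E = w ^ (-(1/p.toReal)) * (w ^ (1/p.toReal) * (a - E)) := by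
            rw [← mul_assoc, hwinv, one_mul]
        _ ≤ _ := by gcongr

lemma aux_main {g h : ℝ → ℝ} (hg : Measurable g) (hh : Measurable h)
    (hgp : ∀ t : ℝ, g (t + 2*π) = g t) (hhp : ∀ t : ℝ, h (t + 2*π) = h t)
    (hgb : ∃ B, ∀ x, |g x| ≤ B) (hhb : ∃ B, ∀ x, |h x| ≤ B)
    {p : ℝ≥0∞} (hp1 : 1 ≤ p) (n : ℕ) (hn : 1 ≤ n) (α E : ℝ) (hE0 : 0 ≤ E)
    (hgE : ∀ δ : ℝ, 0 ≤ δ → δ ≤ 2*π/n →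
      eLpNorm (fun x => g (x + δ) - g x) p muP ≤ ENNReal.ofReal E)
    (hhE : ∀ δ : ℝ, 0 ≤ δ → δ ≤ 2*π/n →
      eLpNorm (fun x => h (x + δ) - h x) p muP ≤ ENNReal.ofReal E) :
    |(⨆ θ : ℝ, (1/2) * LpNormPer p
              (fun x => (g (x+θ) * Real.cos ((n:ℝ)*(x+θ) + α) + h (x+θ) * Real.sin ((n:ℝ)*(x+θ) + α)) -
                        (g x * Real.cos ((n:ℝ)*x + α) + h x * Real.sin ((n:ℝ)*x + α)))) -
            (2*π) ^ (-(1/p.toReal)) * cosLp p * LpNormPer p (rGH g h)| ≤ 3 * E := by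
  have hpi := pi_pos
  have hn0 : (0:ℝ) < n := by exact_mod_cast hn
  have hP := fun β => aux_phi_meas hg hh n β
  have hPs : ∀ β δ, Measurable (fun x => Phi g h n β (x + δ)) := fun β δ =>
    (hP β).comp (measurable_id.add_const δ)
  have hrm : Measurable (rGH g h) := by unfold rGH; fun_prop
  obtain ⟨B1, hB1⟩ := hgb
  obtain ⟨B2, hB2⟩ := hhb
  have hrb : ∀ x, ‖rGH g h x‖ ≤ B1 + B2 := by
    intro x
    have e1 := hB1 x
    have e2 := hB2 x
    have e3 := abs_nonneg (g x)
    have e4 := abs_nonneg (h x)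
    rw [Real.norm_eq_abs, rGH, abs_of_nonneg (sqrt_nonneg _)]
    apply Real.sqrt_le_iff.2
    refine ⟨by linarith, ?_⟩
    rw [← sq_abs (g x), ← sq_abs (h x)]
    nlinarith
  have hrt : eLpNorm (rGH g h) p muP ≠ ∞ :=
    (MemLp.of_bound hrm.aestronglyMeasurable _ (Filter.Eventually.of_forall hrb)).2.ne
  have hct : eLpNorm Real.cos p muP ≠ ∞ :=
    (MemLp.of_bound measurable_cos.aestronglyMeasurable 1
      (Filter.Eventually.of_forall fun x => abs_cos_le_one x)).2.ne
  have hPt : ∀ β, eLpNorm (Phi g h n β) p muP ≠ ∞ := fun β => ne_top_of_le_ne_top hrt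
    (eLpNorm_mono fun x => (aux_phi_le g h n β x).trans (le_abs_self _))
  set a := eLpNorm (Phi g h n α) p muP with ha
  have hsh : ∀ δ, eLpNorm (fun x => Phi g h n α (x + δ)) p muP = a := fun δ =>
    aux_shift_norm (hP α) (aux_phi_per hgp hhp n α) p δ
  have hD : ∀ δ : ℝ, 0 ≤ δ → δ ≤ 2*π/n →
      eLpNorm (fun x => Phi g h n α (x + δ) - Phi g h n (α + n * δ) x) p muP
        ≤ ENNReal.ofReal (2 * E) := by
    intro δ h0 h1
    have hmg : Measurable (fun x => g (x + δ)) := hg.comp (measurable_id.add_const δ)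
    have hmh : Measurable (fun x => h (x + δ)) := hh.comp (measurable_id.add_const δ)
    have heq : (fun x => Phi g h n α (x + δ) - Phi g h n (α + n * δ) x)
        = (fun x => (g (x + δ) - g x) * cos (n * x + (α + n * δ)))
          + (fun x => (h (x + δ) - h x) * sin (n * x + (α + n * δ))) := by
      funext x
      simp only [Phi, Pi.add_apply]
      rw [show (n:ℝ) * (x + δ) + α = n * x + (α + n * δ) by ring]
      ring
    rw [heq, two_mul, ENNReal.ofReal_add hE0 hE0]
    refine (eLpNorm_add_le ?_ ?_ hp1).trans (add_le_add ?_ ?_)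
    · exact Measurable.aestronglyMeasurable (by fun_prop)
    · exact Measurable.aestronglyMeasurable (by fun_prop)
    · refine le_trans (eLpNorm_mono fun x => ?_) (hgE δ h0 h1)
      rw [norm_mul]
      exact mul_le_of_le_one_right (norm_nonneg _) (abs_cos_le_one _)
    · refine le_trans (eLpNorm_mono fun x => ?_) (hhE δ h0 h1)
      rw [norm_mul]
      exact mul_le_of_le_one_right (norm_nonneg _) (abs_sin_le_one _)
  have hDs : ∀ s ∈ Icc 0 (2*π),
      eLpNorm (fun x => Phi g h n α (x + s / n) - Phi g h n (α + s) x) p muP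
        ≤ ENNReal.ofReal (2 * E) := by
    intro s hs
    have := hD (s / n) (div_nonneg hs.1 hn0.le) (by gcongr; exact hs.2)
    rwa [mul_div_cancel₀ _ hn0.ne'] at this
  have hDm : ∀ s, Measurable (fun x => Phi g h n α (x + s / n) - Phi g h n (α + s) x) := fun s =>
    (hPs _ _).sub (hP _)
  obtain ⟨hc1, hc2⟩ := aux_core_ennreal hg hh n α hp1 a (ENNReal.ofReal (2 * E)) ha
    (by
      intro s hs
      have heq : Phi g h n (α + s) = (fun x => Phi g h n α (x + s / n))
          - (fun x => Phi g h n α (x + s / n) - Phi g h n (α + s) x) := by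
        funext x; simp
      rw [heq]
      refine (eLpNorm_sub_le (hPs _ _).aestronglyMeasurable (hDm s).aestronglyMeasurable hp1).trans ?_
      rw [hsh]
      gcongr
      exact hDs s hs)
    (by
      intro s hs
      have heq : (fun x => Phi g h n α (x + s / n)) = Phi g h n (α + s)
          + (fun x => Phi g h n α (x + s / n) - Phi g h n (α + s) x) := by
        funext x; simp
      rw [← hsh (s / n), heq]
      refine (eLpNorm_add_le (hP _).aestronglyMeasurable (hDm s).aestronglyMeasurable hp1).trans ?_
      gcongr
      exact hDs s hs)
  have hat : a ≠ ∞ := hPt α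
  set T := (2*π) ^ (-(1/p.toReal)) * cosLp p * LpNormPer p (rGH g h) with hT
  have hTE : ENNReal.ofReal ((2*π) ^ (-(1/p.toReal))) * eLpNorm Real.cos p muP
      * eLpNorm (rGH g h) p muP = ENNReal.ofReal T := by
    rw [hT, ENNReal.ofReal_mul (by unfold cosLp LpNormPer; positivity),
      ENNReal.ofReal_mul (by positivity), cosLp, LpNormPer, LpNormPer, ENNReal.ofReal_toReal hct,
      ENNReal.ofReal_toReal hrt]
  have hT0 : 0 ≤ T := by rw [hT]; unfold cosLp LpNormPer; positivity
  have ha0 : 0 ≤ a.toReal := ENNReal.toReal_nonneg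
  rw [hTE, ← ENNReal.ofReal_toReal hat, ← ENNReal.ofReal_add (by positivity) (by positivity),
    ENNReal.ofReal_le_ofReal_iff (by positivity)] at hc1
  rw [hTE, ← ENNReal.ofReal_toReal hat, ← ENNReal.ofReal_add (by positivity) (by positivity),
    ENNReal.ofReal_le_ofReal_iff (by positivity)] at hc2
  change |(⨆ θ : ℝ, (1/2) * LpNormPer p (fun x => Phi g h n α (x + θ) - Phi g h n α x)) - T| ≤ 3 * E
  have hdiff : ∀ θ, eLpNorm (fun x => Phi g h n α (x + θ) - Phi g h n α x) p muP ≤ a + a := by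
    intro θ
    have := eLpNorm_sub_le (p := p) (μ := muP) (hPs α θ).aestronglyMeasurable
      (hP α).aestronglyMeasurable hp1
    rw [hsh] at this
    exact this
  have hup : ∀ θ, (1/2) * LpNormPer p (fun x => Phi g h n α (x + θ) - Phi g h n α x) ≤ a.toReal := by
    intro θ
    have := ENNReal.toReal_mono (ENNReal.add_ne_top.2 ⟨hat, hat⟩) (hdiff θ)
    rw [ENNReal.toReal_add hat hat] at this
    unfold LpNormPer
    linarith
  have hlow : a.toReal - E
      ≤ (1/2) * LpNormPer p (fun x => Phi g h n α (x + π / n) - Phi g h n α x) := by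
    have heq : (2:ℝ) • Phi g h n α = (fun x => Phi g h n α (x + π / n) - Phi g h n (α + π) x)
        - (fun x => Phi g h n α (x + π / n) - Phi g h n α x) := by
      funext x
      simp only [Pi.smul_apply, Pi.sub_apply, smul_eq_mul]
      have : Phi g h n (α + π) x = - Phi g h n α x := by
        unfold Phi
        rw [← add_assoc, cos_add_pi, sin_add_pi]; ring
      rw [this]; ring
    have h2 : eLpNorm ((2:ℝ) • Phi g h n α) p muP ≤ ENNReal.ofReal (2 * E)
        + eLpNorm (fun x => Phi g h n α (x + π / n) - Phi g h n α x) p muP := by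
      rw [heq]
      refine (eLpNorm_sub_le (hDm π).aestronglyMeasurable
        ((hPs _ _).sub (hP _)).aestronglyMeasurable hp1).trans ?_
      exact add_le_add (hDs π ⟨hpi.le, by linarith⟩) le_rfl
    have hdt : eLpNorm (fun x => Phi g h n α (x + π / n) - Phi g h n α x) p muP ≠ ∞ :=
      ne_top_of_le_ne_top (ENNReal.add_ne_top.2 ⟨hat, hat⟩) (hdiff _)
    have h3 := ENNReal.toReal_mono (ENNReal.add_ne_top.2 ⟨ENNReal.ofReal_ne_top, hdt⟩) h2
    rw [eLpNorm_const_smul, ENNReal.toReal_mul, ENNReal.toReal_add ENNReal.ofReal_ne_top hdt,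
      ENNReal.toReal_ofReal (by positivity), toReal_enorm, Real.norm_eq_abs, abs_two] at h3
    unfold LpNormPer
    linarith
  have hs1 := ciSup_le hup
  have hs2 := le_ciSup (f := fun θ => (1/2) * LpNormPer p
    (fun x => Phi g h n α (x + θ) - Phi g h n α x)) ⟨a.toReal, by rintro _ ⟨θ, rfl⟩; exact hup θ⟩ (π / n)
  rw [abs_le]
  constructor <;> linarith

lemma aux_lip {g : ℝ → ℝ} {K : ℝ} (hg : ∀ x δ : ℝ, 0 < δ → |g (x + δ) - g x| ≤ K * δ) :
    0 ≤ K ∧ Continuous g := by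
  have hK : 0 ≤ K := by
    have := (abs_nonneg _).trans (hg 0 1 one_pos)
    linarith
  refine ⟨hK, ?_⟩
  have : LipschitzWith K.toNNReal g := by
    apply LipschitzWith.of_dist_le_mul
    intro x y
    rw [Real.coe_toNNReal _ hK, Real.dist_eq, Real.dist_eq]
    rcases lt_trichotomy x y with h | h | h
    · have := hg x (y - x) (by linarith)
      rw [add_sub_cancel] at this
      rw [abs_sub_comm, abs_sub_comm x y, abs_of_pos (sub_pos.2 h)]
      exact this
    · simp [h]
    · have := hg y (x - y) (by linarith)
      rw [add_sub_cancel] at this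
      rw [abs_of_pos (sub_pos.2 h)]
      exact this
  exact this.continuous

lemma aux_lip_bdd {g : ℝ → ℝ} (hg : Continuous g) (hgp : ∀ t : ℝ, g (t + 2*π) = g t) :
    ∃ B, ∀ x, |g x| ≤ B := by
  obtain ⟨B, hB⟩ := (isCompact_Icc (a := (0:ℝ)) (b := 2*π)).exists_bound_of_continuousOn
    hg.continuousOn
  refine ⟨B, fun x => ?_⟩
  obtain ⟨y, hy, hxy⟩ := (show Function.Periodic g (2*π) from hgp).exists_mem_Ico₀ (by positivity) x
  rw [hxy]
  exact hB y (Ico_subset_Icc_self hy)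

lemma aux_lip_shift {g : ℝ → ℝ} {K : ℝ} (hg : ∀ x δ : ℝ, 0 < δ → |g (x + δ) - g x| ≤ K * δ)
    {p : ℝ≥0∞} (hp1 : 1 ≤ p) (n : ℕ) (δ : ℝ) (h0 : 0 ≤ δ) (h1 : δ ≤ 2*π/n) :
    eLpNorm (fun x => g (x + δ) - g x) p muP ≤ ENNReal.ofReal (2*π * (K * (2*π/n))) := by
  have hpi := Real.two_le_pi
  obtain ⟨hK, -⟩ := aux_lip hg
  refine (eLpNorm_le_of_ae_bound (C := K * (2*π/n))
    (Filter.Eventually.of_forall fun x => ?_)).trans ?_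
  · rcases h0.eq_or_lt with h | h
    · subst h
      simp only [add_zero, sub_self, norm_zero]
      positivity
    · exact (hg x δ h).trans (by gcongr)
  · rw [ENNReal.ofReal_mul (p := 2*π) (by positivity)]
    refine mul_le_mul' ?_ le_rfl
    have hmu : muP univ = ENNReal.ofReal (2*π) := by simp [muP]
    rw [hmu]
    have hone : 1 ≤ ENNReal.ofReal (2*π) := by
      rw [ENNReal.one_le_ofReal]; linarith
    calc _ ≤ ENNReal.ofReal (2*π) ^ (1:ℝ) := by
          apply ENNReal.rpow_le_rpow_of_exponent_le hone
          by_cases hpt : p = ∞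
          · simp [hpt]
          · apply inv_le_one_of_one_le₀
            simpa using ENNReal.toReal_mono hpt hp1
      _ = _ := ENNReal.rpow_one _

/-- **Lemma 1, third formula (28).** For `Φ(x) = g(x)cos(nx+α) + h(x)sin(nx+α)`:
`|sup_{θ∈ℝ}(1/2)‖Φ(·+θ) − Φ(·)‖_p − (2π)^{−1/p}‖cos‖_p‖r‖_p| ≤ C·M/n`. -/
theorem statement9 :
    ∃ C : ℝ, 0 < C ∧ ∀ (p : ℝ≥0∞), 1 ≤ p → ∀ (g h : ℝ → ℝ) (K : ℝ),
      (∀ t : ℝ, g (t + 2*π) = g t) → (∀ t : ℝ, h (t + 2*π) = h t) →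
      (p = 1 → BoundedVariationOn g (Icc (0:ℝ) (2*π)) ∧
               BoundedVariationOn h (Icc (0:ℝ) (2*π))) →
      (1 < p → (∀ x δ : ℝ, 0 < δ → |g (x + δ) - g x| ≤ K * δ) ∧
               (∀ x δ : ℝ, 0 < δ → |h (x + δ) - h x| ≤ K * δ)) →
      ∀ (n : ℕ), 1 ≤ n → ∀ (α : ℝ),
        |(⨆ θ : ℝ, (1/2) * LpNormPer p
              (fun x => (g (x+θ) * Real.cos ((n:ℝ)*(x+θ) + α) + h (x+θ) * Real.sin ((n:ℝ)*(x+θ) + α)) -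
                        (g x * Real.cos ((n:ℝ)*x + α) + h x * Real.sin ((n:ℝ)*x + α)))) -
            (2*π) ^ (-(1/p.toReal)) * cosLp p * LpNormPer p (rGH g h)| ≤
          C * MLem p g h K / n := by
  have hpi := Real.two_le_pi
  refine ⟨12 * π ^ 2, by positivity, ?_⟩
  intro p hp1 g h K hgp hhp hbv hlip n hn α
  have hn0 : (0:ℝ) < n := by exact_mod_cast hn
  have hn1 : (1:ℝ) ≤ n := by exact_mod_cast hn
  by_cases hp : p = 1
  · obtain ⟨hgb, hhb⟩ := hbv hp
    have hdd : 2*π/n ≤ 2*π := div_le_self (by positivity) hn1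
    set Vg := (eVariationOn g (Icc (-π) π)).toReal with hVg
    set Vh := (eVariationOn h (Icc (-π) π)).toReal with hVh
    have hVg0 : 0 ≤ Vg := ENNReal.toReal_nonneg
    have hVh0 : 0 ≤ Vh := ENNReal.toReal_nonneg
    refine (aux_main (aux_bv_meas (aux_lbv hgp hgb)) (aux_bv_meas (aux_lbv hhp hhb)) hgp hhp
      (aux_bv_bdd hgp hgb) (aux_bv_bdd hhp hhb) hp1 n hn α (2*π/n * (3 * (Vg + Vh)))
      (by positivity) ?_ ?_).trans ?_
    · intro δ h0 h1
      rw [hp]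
      refine (aux_bv_shift hgp hgb h0 (h1.trans hdd)).trans (ENNReal.ofReal_le_ofReal ?_)
      rw [← hVg]
      gcongr
      linarith
    · intro δ h0 h1
      rw [hp]
      refine (aux_bv_shift hhp hhb h0 (h1.trans hdd)).trans (ENNReal.ofReal_le_ofReal ?_)
      rw [← hVh]
      gcongr
      linarith
    · have hM : MLem p g h K = Vg + Vh := by simp [MLem, hp, hVg, hVh]
      rw [hM, show 3 * (2*π/n * (3 * (Vg + Vh))) = (18 * π) * (Vg + Vh) / n by ring]
      have h18 : 18 * π ≤ 12 * π ^ 2 := by nlinarith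
      exact div_le_div_of_nonneg_right (mul_le_mul_of_nonneg_right h18 (by positivity)) hn0.le
  · obtain ⟨hgl, hhl⟩ := hlip (lt_of_le_of_ne hp1 (Ne.symm hp))
    obtain ⟨hK, hgc⟩ := aux_lip hgl
    obtain ⟨-, hhc⟩ := aux_lip hhl
    refine (aux_main hgc.measurable hhc.measurable hgp hhp
      (aux_lip_bdd hgc hgp) (aux_lip_bdd hhc hhp) hp1 n hn α (2*π * (K * (2*π/n)))
      (by positivity) (aux_lip_shift hgl hp1 n) (aux_lip_shift hhl hp1 n)).trans ?_
    have hM : K ≤ MLem p g h K := by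
      unfold MLem
      rw [if_neg hp]
      split_ifs
      · exact le_rfl
      · have : 0 ≤ LpNormPer p (rGH g h) := ENNReal.toReal_nonneg
        exact le_add_of_nonneg_right (by positivity)
    rw [show 3 * (2*π * (K * (2*π/n))) = 12 * π ^ 2 * K / n by ring]
    gcongr
end
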